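/- arXiv:1206.3510 — 3 statements merged into one kernel-verified Lean document; each statement's English description precedes it below -/
import Mathlib

section
/- For every positive integer n, there exist polynomials γ_{n,k}(q) with nonnegative integer coefficients, for 0 ≤ k ≤ ⌊(n-1)/2⌋, such that Σ_{σ ∈ S_n} q^{inv σ − exc σ} t^{exc σ} = Σ_{k=0}^{⌊(n-1)/2⌋} γ_{n,k}(q) · t^k · (1+t)^{n-1-2k}, as an identity of polynomials in q and t. -/
open Finset MvPolynomial

/-- The value `σ(i)` for a permutation of `{1,…,n}` encoded as `Equiv.Perm (Fin n)`,
with the convention `σ(i) = 0` for `i = 0` and `i = n+1` (indeed for all `i ∉ [n]`). -/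
def pval (n : ℕ) (σ : Equiv.Perm (Fin n)) (i : ℕ) : ℕ :=
  if h : 1 ≤ i ∧ i ≤ n then ((σ ⟨i - 1, by omega⟩ : Fin n) : ℕ) + 1 else 0

/-- Number of inversions: pairs `1 ≤ i < j ≤ n` with `σ(i) > σ(j)`. -/
def inv (n : ℕ) (σ : Equiv.Perm (Fin n)) : ℕ :=
  ((Finset.Icc 1 n ×ˢ Finset.Icc 1 n).filter
    (fun p => p.1 < p.2 ∧ pval n σ p.2 < pval n σ p.1)).card

/-- Number of excedances: indices `i ∈ [n]` with `i < σ(i)`. -/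
def exc (n : ℕ) (σ : Equiv.Perm (Fin n)) : ℕ :=
  ((Finset.Icc 1 n).filter (fun i => i < pval n σ i)).card

/-- Number of drops: indices `i ∈ [n]` with `i > σ(i)`. -/
def drp (n : ℕ) (σ : Equiv.Perm (Fin n)) : ℕ :=
  ((Finset.Icc 1 n).filter (fun i => pval n σ i < i)).card

/-- Number of descents: indices `1 ≤ i < n` with `σ(i) > σ(i+1)`. -/
def des (n : ℕ) (σ : Equiv.Perm (Fin n)) : ℕ :=
  ((Finset.Icc 1 (n - 1)).filter (fun i => pval n σ (i + 1) < pval n σ i)).card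

/-- `les σ`: number of pairs `2 ≤ i < j ≤ n` with `σ(i-1) > σ(j) > σ(i)`. -/
def les (n : ℕ) (σ : Equiv.Perm (Fin n)) : ℕ :=
  ((Finset.Icc 2 n ×ˢ Finset.Icc 2 n).filter
    (fun p => p.1 < p.2 ∧ pval n σ p.2 < pval n σ (p.1 - 1) ∧
      pval n σ p.1 < pval n σ p.2)).card

/-- `res σ`: number of pairs `1 ≤ i < j ≤ n-1` with `σ(j+1) > σ(i) > σ(j)`. -/
def res (n : ℕ) (σ : Equiv.Perm (Fin n)) : ℕ :=
  ((Finset.Icc 1 (n - 1) ×ˢ Finset.Icc 1 (n - 1)).filter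
    (fun p => p.1 < p.2 ∧ pval n σ p.2 < pval n σ p.1 ∧
      pval n σ p.1 < pval n σ (p.2 + 1))).card

/-- `ress σ`: number of pairs `1 ≤ i < j ≤ n-1` with `σ(j+1) < σ(i) < σ(j)`. -/
def ress (n : ℕ) (σ : Equiv.Perm (Fin n)) : ℕ :=
  ((Finset.Icc 1 (n - 1) ×ˢ Finset.Icc 1 (n - 1)).filter
    (fun p => p.1 < p.2 ∧ pval n σ (p.2 + 1) < pval n σ p.1 ∧
      pval n σ p.1 < pval n σ p.2)).card

/-- Crossing number: pairs `(i,j) ∈ [n]×[n]` with `i < j ≤ σ(i) < σ(j)` or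
`i > j > σ(i) > σ(j)`. -/
def cros (n : ℕ) (σ : Equiv.Perm (Fin n)) : ℕ :=
  ((Finset.Icc 1 n ×ˢ Finset.Icc 1 n).filter
    (fun p => (p.1 < p.2 ∧ p.2 ≤ pval n σ p.1 ∧ pval n σ p.1 < pval n σ p.2) ∨
      (p.2 < p.1 ∧ pval n σ p.1 < p.2 ∧ pval n σ p.2 < pval n σ p.1))).card

/-- Nesting number: pairs `(i,j) ∈ [n]×[n]` with `i < j ≤ σ(j) < σ(i)` or
`i > j > σ(j) > σ(i)`. -/
def nest (n : ℕ) (σ : Equiv.Perm (Fin n)) : ℕ :=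
  ((Finset.Icc 1 n ×ˢ Finset.Icc 1 n).filter
    (fun p => (p.1 < p.2 ∧ p.2 ≤ pval n σ p.2 ∧ pval n σ p.2 < pval n σ p.1) ∨
      (p.2 < p.1 ∧ pval n σ p.2 < p.2 ∧ pval n σ p.1 < pval n σ p.2))).card

/-- Number of valleys: `i ∈ [n]` with `σ(i-1) > σ(i)` and `σ(i) < σ(i+1)`
(convention `σ(0) = σ(n+1) = 0`). -/
def valleys (n : ℕ) (σ : Equiv.Perm (Fin n)) : ℕ :=
  ((Finset.Icc 1 n).filter
    (fun i => pval n σ i < pval n σ (i - 1) ∧ pval n σ i < pval n σ (i + 1))).card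

/-- Number of double descents: `i ∈ [n]` with `σ(i-1) > σ(i)` and `σ(i) > σ(i+1)`
(convention `σ(0) = σ(n+1) = 0`). -/
def ddes (n : ℕ) (σ : Equiv.Perm (Fin n)) : ℕ :=
  ((Finset.Icc 1 n).filter
    (fun i => pval n σ i < pval n σ (i - 1) ∧ pval n σ (i + 1) < pval n σ i)).card

/-- `S_{n,k}`: permutations of `[n]` with exactly `k` valleys and no double descents. -/
def Snk (n k : ℕ) : Finset (Equiv.Perm (Fin n)) :=
  Finset.univ.filter (fun σ => valleys n σ = k ∧ ddes n σ = 0)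

/-- The permutation of `Fin (N + 1)` sending `i` to `j` and acting as `τ` off `i`. -/
def insertPerm {N : ℕ} (i j : Fin (N + 1)) (τ : Equiv.Perm (Fin N)) : Equiv.Perm (Fin (N + 1)) :=
  (finSuccEquiv' i).trans ((Equiv.optionCongr τ).trans (finSuccEquiv' j).symm)

@[simp] lemma insertPerm_self {N : ℕ} (i j : Fin (N + 1)) (τ : Equiv.Perm (Fin N)) :
    insertPerm i j τ i = j := by
  simp [insertPerm]

@[simp] lemma insertPerm_succAbove {N : ℕ} (i j : Fin (N + 1)) (τ : Equiv.Perm (Fin N))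
    (k : Fin N) : insertPerm i j τ (i.succAbove k) = j.succAbove (τ k) := by
  simp [insertPerm]

lemma insertPerm_injective {N : ℕ} (i j : Fin (N + 1)) :
    Function.Injective (insertPerm i j) := by
  intro τ τ' h
  ext k
  have := congrArg (fun σ => σ (i.succAbove k)) h
  simp only [insertPerm_succAbove] at this
  rw [Fin.succAbove_right_injective this]

lemma exists_insertPerm_eq {N : ℕ} (i : Fin (N + 1)) (σ : Equiv.Perm (Fin (N + 1))) :
    ∃ τ, insertPerm i (σ i) τ = σ := by
  have hne : ∀ k, ∃ l, (σ i).succAbove l = σ (i.succAbove k) := fun k =>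
    Fin.exists_succAbove_eq (fun h => Fin.succAbove_ne i k (σ.injective h))
  choose f hf using hne
  have hinj : Function.Injective f := fun a b hab =>
    Fin.succAbove_right_injective (σ.injective (by rw [← hf a, ← hf b, hab]))
  refine ⟨Equiv.ofBijective f (Finite.injective_iff_bijective.mp hinj), Equiv.ext fun a => ?_⟩
  rcases Fin.eq_self_or_eq_succAbove i a with rfl | ⟨k, rfl⟩
  · simp
  · simp [hf]

lemma sum_filter_apply_eq {R : Type*} [AddCommMonoid R] {N : ℕ} (i j : Fin (N + 1))
    (g : Equiv.Perm (Fin (N + 1)) → R) :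
    ∑ σ with σ i = j, g σ = ∑ τ, g (insertPerm i j τ) := by
  symm
  refine Finset.sum_nbij (insertPerm i j) (by simp) (insertPerm_injective i j).injOn ?_
    (fun _ _ => rfl)
  intro σ hσ
  obtain ⟨τ, hτ⟩ := exists_insertPerm_eq i σ
  have hj : σ i = j := by simpa using hσ
  exact ⟨τ, by simp, by rw [← hj, hτ]⟩

lemma sum_perm_eq_sum_value {R : Type*} [AddCommMonoid R] {N : ℕ} (i : Fin (N + 1))
    (g : Equiv.Perm (Fin (N + 1)) → R) :
    ∑ σ, g σ = ∑ j, ∑ τ, g (insertPerm i j τ) := by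
  simp_rw [← sum_filter_apply_eq]
  exact (Finset.sum_fiberwise _ _ _).symm

lemma sum_perm_eq_sum_index {R : Type*} [AddCommMonoid R] {N : ℕ} (j : Fin (N + 1))
    (g : Equiv.Perm (Fin (N + 1)) → R) :
    ∑ σ, g σ = ∑ i, ∑ τ, g (insertPerm i j τ) := by
  simp_rw [← sum_filter_apply_eq, ← Equiv.eq_symm_apply, eq_comm (b := Equiv.symm _ j)]
  exact (Finset.sum_fiberwise _ (fun σ : Equiv.Perm (Fin (N + 1)) => σ.symm j) _).symm

lemma sum_Icc_one_eq_sum_fin {R : Type*} [AddCommMonoid R] (n : ℕ) (f : ℕ → R) :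
    ∑ i ∈ Finset.Icc 1 n, f i = ∑ i : Fin n, f (i + 1) := by
  rw [← Finset.sum_range (fun i => f (i + 1)), Finset.range_eq_Ico, Finset.sum_Ico_add' f 0 n 1]
  rfl

lemma pval_succ {n : ℕ} (σ : Equiv.Perm (Fin n)) (i : Fin n) : pval n σ (i + 1) = σ i + 1 := by
  simp [pval]

lemma inv_eq_sum {n : ℕ} (σ : Equiv.Perm (Fin n)) :
    inv n σ = ∑ a : Fin n, ∑ b : Fin n, if a < b ∧ σ b < σ a then 1 else 0 := by
  rw [inv, Finset.card_filter, Finset.sum_product, sum_Icc_one_eq_sum_fin]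
  simp_rw [sum_Icc_one_eq_sum_fin, pval_succ]
  simp

lemma exc_eq_sum {n : ℕ} (σ : Equiv.Perm (Fin n)) :
    exc n σ = ∑ a : Fin n, if a < σ a then 1 else 0 := by
  rw [exc, Finset.card_filter, sum_Icc_one_eq_sum_fin]
  simp [pval_succ]

lemma exc_le_inv {n : ℕ} (σ : Equiv.Perm (Fin n)) : exc n σ ≤ inv n σ := by
  rw [exc_eq_sum, inv_eq_sum]
  refine Finset.sum_le_sum fun a _ => ?_
  split_ifs with ha
  · obtain ⟨b, hb⟩ : ∃ b, a < b ∧ σ b < σ a := by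
      by_contra! h
      have hsub : (Finset.Ici a).map σ.toEmbedding ⊆ Finset.Ioi a := by
        intro c hc
        obtain ⟨b, hb, rfl⟩ := Finset.mem_map.mp hc
        rcases (Finset.mem_Ici.mp hb).eq_or_lt with rfl | hb
        · simpa using ha
        · simpa using ha.trans_le (h b hb)
      have hcard := Finset.card_le_card hsub
      rw [Finset.card_map, Fin.card_Ici, Fin.card_Ioi] at hcard
      omega
    calc 1 = if a < b ∧ σ b < σ a then 1 else 0 := by rw [if_pos hb]
      _ ≤ _ := Finset.single_le_sum (f := fun b => if a < b ∧ σ b < σ a then 1 else 0)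
        (fun _ _ => Nat.zero_le _) (Finset.mem_univ b)
  · exact Nat.zero_le _

lemma succAbove_lt_iff_val {N : ℕ} (i : Fin (N + 1)) (k : Fin N) :
    i.succAbove k < i ↔ (k : ℕ) < i := by
  rw [Fin.succAbove_lt_iff_castSucc_lt, Fin.lt_def, Fin.val_castSucc]

lemma lt_succAbove_iff_val {N : ℕ} (i : Fin (N + 1)) (k : Fin N) :
    i < i.succAbove k ↔ (i : ℕ) ≤ k := by
  rw [Fin.lt_succAbove_iff_le_castSucc, Fin.le_def, Fin.val_castSucc]

lemma val_succAbove {N : ℕ} (i : Fin (N + 1)) (k : Fin N) :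
    (i.succAbove k : ℕ) = if (k : ℕ) < i then (k : ℕ) else k + 1 := by
  simp only [Fin.succAbove, Fin.lt_def, Fin.val_castSucc]
  split_ifs <;> simp

lemma sum_fin_ite_lt {N : ℕ} (i : Fin (N + 1)) :
    (∑ k : Fin N, if (k : ℕ) < i then 1 else 0) = (i : ℕ) := by
  rw [← Finset.sum_range (fun k => if k < (i : ℕ) then 1 else 0), ← Finset.card_filter]
  have : (Finset.range N).filter (· < (i : ℕ)) = Finset.range i := by
    ext k; simp; omega
  rw [this, Finset.card_range]

lemma inv_insertPerm {N : ℕ} (i j : Fin (N + 1)) (τ : Equiv.Perm (Fin N))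
    (h : ∀ k : Fin N, (k : ℕ) < i → (j : ℕ) ≤ τ k) :
    inv (N + 1) (insertPerm i j τ) = inv N τ + i + j := by
  have h₁ : (∑ k : Fin N, if i < i.succAbove k ∧ j.succAbove (τ k) < j then 1 else 0)
      = (j : ℕ) := by
    rw [← sum_fin_ite_lt j, ← Equiv.sum_comp τ (fun k => if (k : ℕ) < j then 1 else 0)]
    refine Finset.sum_congr rfl fun k _ => ?_
    have := h k
    exact if_congr (by rw [lt_succAbove_iff_val, succAbove_lt_iff_val]; omega) rfl rfl
  have h₂ : (∑ k : Fin N, if i.succAbove k < i ∧ j < j.succAbove (τ k) then 1 else 0)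
      = (i : ℕ) := by
    rw [← sum_fin_ite_lt i]
    refine Finset.sum_congr rfl fun k _ => ?_
    have := h k
    exact if_congr (by rw [lt_succAbove_iff_val, succAbove_lt_iff_val]; omega) rfl rfl
  simp_rw [inv_eq_sum, Fin.sum_univ_succAbove _ i, insertPerm_self, insertPerm_succAbove,
    (Fin.strictMono_succAbove _).lt_iff_lt, Finset.sum_add_distrib, h₁, h₂]
  simp
  omega

lemma exc_insertPerm {N : ℕ} (i j : Fin (N + 1)) (τ : Equiv.Perm (Fin N))
    (h : ∀ k : Fin N, i.succAbove k < j.succAbove (τ k) ↔ k < τ k) :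
    exc (N + 1) (insertPerm i j τ) = exc N τ + if i < j then 1 else 0 := by
  simp_rw [exc_eq_sum, Fin.sum_univ_succAbove _ i, insertPerm_self, insertPerm_succAbove, h]
  exact Nat.add_comm _ _

section Recurrence

variable {R : Type*} [CommSemiring R] (q t : R)

/-- The weight `q ^ (inv σ - exc σ) * t ^ exc σ` of a permutation. -/
def permWeight {N : ℕ} (σ : Equiv.Perm (Fin N)) : R :=
  q ^ (inv N σ - exc N σ) * t ^ exc N σ

/-- The weight of `σ` if all of the first `h` values of `σ` are at least `m`, and `0` otherwise. -/
def restrictedWeight {N : ℕ} (h m : ℕ) (σ : Equiv.Perm (Fin N)) : R :=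
  if ∀ a : Fin N, (a : ℕ) < h → m ≤ (σ a : ℕ) then permWeight q t σ else 0

/-- The generating function of the permutations whose first `h` values are all at least `m`. -/
def restrictedSum (N h m : ℕ) : R :=
  ∑ σ : Equiv.Perm (Fin N), restrictedWeight q t h m σ

lemma forall_insertPerm_iff {N : ℕ} (i j : Fin (N + 1)) (τ : Equiv.Perm (Fin N)) (h m : ℕ) :
    (∀ a : Fin (N + 1), (a : ℕ) < h → m ≤ (insertPerm i j τ a : ℕ)) ↔
      ((i : ℕ) < h → m ≤ (j : ℕ)) ∧
        ∀ k : Fin N, (i.succAbove k : ℕ) < h → m ≤ (j.succAbove (τ k) : ℕ) := by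
  rw [Fin.forall_iff_succAbove i]
  simp

lemma restrictedWeight_insertPerm_column {N : ℕ} (i j : Fin (N + 1)) (τ : Equiv.Perm (Fin N)) :
    restrictedWeight q t j j (insertPerm i j τ) =
      restrictedWeight q t j (j + 1) (insertPerm i j τ) +
        if (i : ℕ) < j then t * q ^ (i + j - 1 : ℕ) * restrictedWeight q t (j - 1) j τ else 0 := by
  have hval := fun k : Fin N => val_succAbove j (τ k)
  have hpos := fun k : Fin N => val_succAbove i k
  by_cases hij : (i : ℕ) < j
  · have hO : ¬ ∀ a : Fin (N + 1), (a : ℕ) < j → (j + 1 : ℕ) ≤ (insertPerm i j τ a : ℕ) := by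
      intro H
      have := H i hij
      simp at this
    have hiff : (∀ a : Fin (N + 1), (a : ℕ) < j → (j : ℕ) ≤ (insertPerm i j τ a : ℕ)) ↔
        ∀ k : Fin N, (k : ℕ) < j - 1 → (j : ℕ) ≤ (τ k : ℕ) := by
      rw [forall_insertPerm_iff]
      refine ⟨fun H k hk => ?_, fun H => ⟨fun _ => le_rfl, fun k hk => ?_⟩⟩
      · have := H.2 k
        grind
      · have := H k
        grind
    rw [restrictedWeight, restrictedWeight, restrictedWeight, if_neg hO, if_pos hij, zero_add]
    by_cases H : ∀ k : Fin N, (k : ℕ) < j - 1 → (j : ℕ) ≤ (τ k : ℕ)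
    · rw [if_pos (hiff.mpr H), if_pos H, permWeight, permWeight,
        inv_insertPerm i j τ (fun k hk => H k (by omega)),
        exc_insertPerm i j τ (fun k => by
          have := H k
          rw [Fin.lt_def, Fin.lt_def]
          grind), if_pos (Fin.lt_def.mpr hij)]
      have := exc_le_inv τ
      rw [show inv N τ + i + j - (exc N τ + 1) = (inv N τ - exc N τ) + (i + j - 1) by omega]
      ring
    · rw [if_neg (fun H' => H (hiff.mp H')), if_neg H, mul_zero]
  · rw [if_neg hij, add_zero, restrictedWeight, restrictedWeight]
    refine if_congr ?_ rfl rfl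
    rw [forall_insertPerm_iff, forall_insertPerm_iff]
    refine and_congr (by omega) (forall_congr' fun k => imp_congr_right fun _ => ?_)
    grind

lemma restrictedWeight_insertPerm_row {N : ℕ} (i j : Fin (N + 1)) (τ : Equiv.Perm (Fin N)) :
    restrictedWeight q t i (i + 1) (insertPerm i j τ) =
      restrictedWeight q t (i + 1) (i + 1) (insertPerm i j τ) +
        if (j : ℕ) ≤ i then q ^ (i + j : ℕ) * restrictedWeight q t i i τ else 0 := by
  have hval := fun k : Fin N => val_succAbove j (τ k)
  have hpos := fun k : Fin N => val_succAbove i k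
  by_cases hij : (j : ℕ) ≤ i
  · have hE : ¬ ∀ a : Fin (N + 1), (a : ℕ) < i + 1 → (i + 1 : ℕ) ≤ (insertPerm i j τ a : ℕ) := by
      intro H
      have := H i (by omega)
      simp at this
      omega
    have hiff : (∀ a : Fin (N + 1), (a : ℕ) < i → (i + 1 : ℕ) ≤ (insertPerm i j τ a : ℕ)) ↔
        ∀ k : Fin N, (k : ℕ) < i → (i : ℕ) ≤ (τ k : ℕ) := by
      rw [forall_insertPerm_iff]
      refine ⟨fun H k hk => ?_, fun H => ⟨fun _ => by omega, fun k hk => ?_⟩⟩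
      · have := H.2 k
        grind
      · have := H k
        grind
    rw [restrictedWeight, restrictedWeight, restrictedWeight, if_neg hE, if_pos hij, zero_add]
    by_cases H : ∀ k : Fin N, (k : ℕ) < i → (i : ℕ) ≤ (τ k : ℕ)
    · rw [if_pos (hiff.mpr H), if_pos H, permWeight, permWeight,
        inv_insertPerm i j τ (fun k hk => hij.trans (H k hk)),
        exc_insertPerm i j τ (fun k => by
          have := H k
          rw [Fin.lt_def, Fin.lt_def]
          grind), if_neg (fun h => absurd (Fin.lt_def.mp h) (by omega))]
      have := exc_le_inv τ
      rw [show inv N τ + i + j - (exc N τ + 0) = (inv N τ - exc N τ) + (i + j) by omega]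
      ring
    · rw [if_neg (fun H' => H (hiff.mp H')), if_neg H, mul_zero]
  · rw [if_neg hij, add_zero, restrictedWeight, restrictedWeight]
    refine if_congr ?_ rfl rfl
    rw [forall_insertPerm_iff, forall_insertPerm_iff]
    refine and_congr (by omega) (forall_congr' fun k => imp_congr_left ?_)
    grind

/-- The shifted `q`-integer `q ^ (h - 1) * (1 + q + ⋯ + q ^ (h - 1))`. -/
noncomputable def shiftedQInt (h : ℕ) : Polynomial ℕ :=
  ∑ j ∈ Finset.range h, Polynomial.X ^ (j + h - 1)

lemma eval_shiftedQInt (h : ℕ) : (shiftedQInt h).eval₂ (Nat.castRingHom R) q =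
    ∑ j ∈ Finset.range h, q ^ (j + h - 1) := by
  simp [shiftedQInt, Polynomial.eval₂_finsetSum]

lemma sum_fin_ite_lt_eq_sum_range {N h : ℕ} (hh : h ≤ N) (f : ℕ → R) :
    (∑ i : Fin N, if (i : ℕ) < h then f i else 0) = ∑ i ∈ Finset.range h, f i := by
  rw [← Finset.sum_range (fun i => if i < h then f i else 0), ← Finset.sum_filter]
  congr 1
  ext i
  simp
  omega

lemma restrictedSum_column {N h : ℕ} (hh : h ≤ N) :
    restrictedSum q t (N + 1) h h = restrictedSum q t (N + 1) h (h + 1) +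
      t * (shiftedQInt h).eval₂ (Nat.castRingHom R) q * restrictedSum q t N (h - 1) h := by
  let j : Fin (N + 1) := ⟨h, by omega⟩
  have key := fun i τ => restrictedWeight_insertPerm_column (N := N) q t i j τ
  simp only [j] at key
  simp only [restrictedSum]
  rw [sum_perm_eq_sum_index j, sum_perm_eq_sum_index j, eval_shiftedQInt,
    Finset.mul_sum (Finset.range h), Finset.sum_mul, ← sum_fin_ite_lt_eq_sum_range (N := N + 1) (by omega)
      (fun i => t * q ^ (i + h - 1) * ∑ σ : Equiv.Perm (Fin N), restrictedWeight q t (h - 1) h σ),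
    ← Finset.sum_add_distrib]
  refine Finset.sum_congr rfl fun i _ => ?_
  simp only [j, key, Finset.sum_add_distrib]
  split_ifs <;> simp [Finset.mul_sum]

lemma restrictedSum_row {N h : ℕ} (hh : h ≤ N) :
    restrictedSum q t (N + 1) h (h + 1) = restrictedSum q t (N + 1) (h + 1) (h + 1) +
      (shiftedQInt (h + 1)).eval₂ (Nat.castRingHom R) q * restrictedSum q t N h h := by
  let i : Fin (N + 1) := ⟨h, by omega⟩
  have key := fun j τ => restrictedWeight_insertPerm_row (N := N) q t i j τ
  simp only [i] at key
  simp only [restrictedSum]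
  rw [sum_perm_eq_sum_value i, sum_perm_eq_sum_value i, eval_shiftedQInt,
    Finset.sum_mul, ← sum_fin_ite_lt_eq_sum_range (N := N + 1) (by omega)
      (fun j => q ^ (j + (h + 1) - 1) * ∑ σ : Equiv.Perm (Fin N), restrictedWeight q t h h σ),
    ← Finset.sum_add_distrib]
  refine Finset.sum_congr rfl fun j _ => ?_
  simp only [i, key, Finset.sum_add_distrib, Nat.lt_succ_iff]
  congr 1
  split_ifs
  · rw [Finset.mul_sum, ← add_assoc, Nat.add_sub_cancel, add_comm h]
  · simp

lemma restrictedSum_eq_zero {N h : ℕ} (hN : 0 < N) (h0 : 0 < h) (hh : N ≤ h + 1) :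
    restrictedSum q t N h (h + 1) = 0 := by
  refine Finset.sum_eq_zero fun σ _ => if_neg fun H => ?_
  have := H ⟨0, hN⟩ h0
  omega

/-- The span, over polynomials in `q` with natural coefficients, of the `t ^ k * (1 + t) ^ e`
with `2 * k + e = d`. -/
def gammaSpan (d : ℕ) : AddSubmonoid R :=
  AddSubmonoid.closure {x | ∃ (c : Polynomial ℕ) (k e : ℕ), 2 * k + e = d ∧
    x = c.eval₂ (Nat.castRingHom R) q * t ^ k * (1 + t) ^ e}

variable {q t}

lemma mul_mem_gammaSpan {d k e : ℕ} (c : Polynomial ℕ) {x : R} (hx : x ∈ gammaSpan q t d) :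
    c.eval₂ (Nat.castRingHom R) q * t ^ k * (1 + t) ^ e * x ∈ gammaSpan q t (d + 2 * k + e) := by
  induction hx using AddSubmonoid.closure_induction with
  | mem x hx =>
    obtain ⟨c', k', e', hd, rfl⟩ := hx
    refine AddSubmonoid.subset_closure ⟨c * c', k + k', e + e', by omega, ?_⟩
    rw [Polynomial.eval₂_mul]
    ring
  | zero => simp
  | add x y _ _ hx hy =>
    rw [mul_add]
    exact add_mem hx hy

lemma exists_eq_sum_of_mem_gammaSpan {d : ℕ} {x : R} (hx : x ∈ gammaSpan q t d) :
    ∃ γ : ℕ → Polynomial ℕ, x = ∑ k ∈ Finset.range (d / 2 + 1),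
      (γ k).eval₂ (Nat.castRingHom R) q * t ^ k * (1 + t) ^ (d - 2 * k) := by
  induction hx using AddSubmonoid.closure_induction with
  | mem x hx =>
    obtain ⟨c, k, e, rfl, rfl⟩ := hx
    refine ⟨Pi.single k c, ?_⟩
    rw [Finset.sum_eq_single_of_mem k (Finset.mem_range.mpr (by omega))]
    · simp
    · intro l _ hl
      simp [Pi.single_eq_of_ne hl]
  | zero => exact ⟨0, by simp⟩
  | add x y _ _ hx hy =>
    obtain ⟨γ, rfl⟩ := hx
    obtain ⟨γ', rfl⟩ := hy
    refine ⟨γ + γ', ?_⟩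
    simp only [Pi.add_apply, Polynomial.eval₂_add, add_mul, Finset.sum_add_distrib]

variable (q t)

lemma restrictedSum_zero_eq (N : ℕ) :
    restrictedSum q t (N + 1) 0 0 = restrictedSum q t (N + 1) 0 1 := by
  simp [restrictedSum, restrictedWeight]

lemma restrictedSum_one : restrictedSum q t 1 0 1 = 1 := by
  simp [restrictedSum, restrictedWeight, permWeight, inv_eq_sum, exc_eq_sum]

lemma restrictedSum_mem_gammaSpan (N h : ℕ) :
    restrictedSum q t (N + 1) h (h + 1) ∈ gammaSpan q t N := by
  induction N using Nat.strong_induction_on generalizing h with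
  | _ N ih =>
  rcases Nat.eq_zero_or_pos N with rfl | hN
  · rcases Nat.eq_zero_or_pos h with rfl | h0
    · rw [restrictedSum_one]
      exact AddSubmonoid.subset_closure ⟨1, 0, 0, rfl, by simp⟩
    · rw [restrictedSum_eq_zero q t (by omega) h0 (by omega)]
      exact zero_mem _
  obtain ⟨M, rfl⟩ := Nat.exists_eq_add_of_le' hN
  by_cases hh : M + 1 ≤ h
  · rw [restrictedSum_eq_zero q t (by omega) (by omega) (by omega)]
    exact zero_mem _
  induction hk : M + 1 - h generalizing h with
  | zero => omega
  | succ k ihk =>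
  have hup : restrictedSum q t (M + 1 + 1) (h + 1) (h + 1 + 1) ∈ gammaSpan q t (M + 1) := by
    by_cases hh' : M + 1 ≤ h + 1
    · rw [restrictedSum_eq_zero q t (by omega) (by omega) (by omega)]
      exact zero_mem _
    · exact ihk (h + 1) hh' (by omega)
  have hlevel := mul_mem_gammaSpan (k := 0) (e := 1) (shiftedQInt (h + 1))
    (ih M (by omega) h)
  rw [restrictedSum_row q t (by omega), restrictedSum_column q t (by omega),
    restrictedSum_column (N := M) q t (by omega), Nat.add_sub_cancel]
  simp only [pow_zero, pow_one, mul_one, mul_zero, add_zero] at hlevel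
  rcases Nat.eq_zero_or_pos h with rfl | h0
  · convert add_mem hup hlevel using 1
    simp [shiftedQInt]
    ring
  obtain ⟨l, rfl⟩ := Nat.exists_eq_add_of_le' h0
  have hdown : t * (shiftedQInt (l + 1)).eval₂ (Nat.castRingHom R) q *
      (shiftedQInt (l + 1 + 1)).eval₂ (Nat.castRingHom R) q * restrictedSum q t M l (l + 1) ∈
      gammaSpan q t (M + 1) := by
    obtain ⟨L, rfl⟩ : ∃ L, M = L + 1 := Nat.exists_eq_add_of_le' (by omega)
    convert mul_mem_gammaSpan (k := 1) (e := 0) (shiftedQInt (l + 1) * shiftedQInt (l + 1 + 1))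
      (ih L (by omega) l) using 1
    rw [Polynomial.eval₂_mul]
    ring
  convert add_mem (add_mem hup hlevel) hdown using 1
  rw [Nat.add_sub_cancel]
  ring

end Recurrence

/-- Blanco–Petersen conjecture. For every positive integer `n` there exist
polynomials `γ_{n,k}(q)` with nonnegative integer coefficients such that
`Σ_{σ ∈ S_n} q^(inv σ - exc σ) t^(exc σ) = Σ_k γ_{n,k}(q) t^k (1+t)^(n-1-2k)`. -/
theorem statement0 (n : ℕ) (hn : 0 < n) :
    ∃ γ : ℕ → Polynomial ℕ,
      (∑ σ : Equiv.Perm (Fin n),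
        (X 0 : MvPolynomial (Fin 2) ℤ) ^ (inv n σ - exc n σ) * (X 1) ^ (exc n σ)) =
      ∑ k ∈ Finset.range ((n - 1) / 2 + 1),
        (γ k).eval₂ (Nat.castRingHom (MvPolynomial (Fin 2) ℤ)) (X 0) *
          (X 1) ^ k * (1 + X 1) ^ (n - 1 - 2 * k) := by
  obtain ⟨N, rfl⟩ := Nat.exists_eq_add_of_le' hn
  obtain ⟨γ, hγ⟩ := exists_eq_sum_of_mem_gammaSpan
    (restrictedSum_mem_gammaSpan (X 0 : MvPolynomial (Fin 2) ℤ) (X 1) N 0)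
  refine ⟨γ, ?_⟩
  rw [Nat.add_sub_cancel, ← hγ, zero_add, ← restrictedSum_zero_eq]
  simp [restrictedSum, restrictedWeight, permWeight]
end

section
/- For every positive integer n and every 0 ≤ k ≤ ⌊(n-1)/2⌋, the polynomial γ_{n,k}(q) = Σ_{σ ∈ S_{n,k}} q^{2·res σ + les σ} is divisible by q^k (1+q)^k in ℤ[q]. -/
open Finset MvPolynomial

/-- Number of consecutive triples of a list satisfying `p`. -/
def tripleCount (p : ℕ → ℕ → ℕ → Prop) [∀ a b c, Decidable (p a b c)] : List ℕ → ℕ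
  | a :: b :: c :: t => (if p a b c then 1 else 0) + tripleCount p (b :: c :: t)
  | _ => 0

/-- Number of consecutive pairs `(b, c)` of a list with `b < x < c`. -/
def straddle (x : ℕ) : List ℕ → ℕ
  | b :: c :: t => (if b < x ∧ x < c then 1 else 0) + straddle x (c :: t)
  | _ => 0

/-- Number of occurrences of the vincular pattern `2-13` in a list. -/
def resList : List ℕ → ℕ
  | [] => 0
  | x :: t => straddle x t + resList t

/-- The middle entry of the triple is a valley. -/
abbrev IsValley (a b c : ℕ) : Prop := b < a ∧ b < c

/-- The middle entry of the triple is a double descent. -/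
abbrev IsDoubleDescent (a b c : ℕ) : Prop := b < a ∧ c < b

/-- Number of valleys of a list bordered by zeros. -/
def valleyCount (t : List ℕ) : ℕ := tripleCount IsValley (0 :: (t ++ [0]))

/-- Number of double descents of a list bordered by zeros. -/
def doubleDescentCount (t : List ℕ) : ℕ := tripleCount IsDoubleDescent (0 :: (t ++ [0]))

/-- Words obtained from a permutation without double descents by replacing each maximal run of
letters larger than `v` by the single placeholder `M`. -/
structure IsStageWord (M v : ℕ) (t : List ℕ) : Prop where
  ne_nil : t ≠ []
  letters : ∀ x ∈ t, (1 ≤ x ∧ x ≤ v) ∨ x = M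
  count_eq : ∀ u, 1 ≤ u → u ≤ v → t.count u = 1
  chain : t.IsChain (fun a b => a = M → b ≠ M)
  noDoubleDescent : doubleDescentCount t = 0

/-- All ways to write a list as `A ++ M :: B`. -/
def splits (M : ℕ) : List ℕ → Finset (List ℕ × List ℕ)
  | [] => ∅
  | x :: t => (if x = M then {([], t)} else ∅) ∪ (splits M t).image (fun p => (x :: p.1, p.2))

/-- All stage words, obtained by replacing in turn one placeholder `M` of the previous word by
`M v M`, `v M` or `v`. -/
def stageWords (M : ℕ) : ℕ → Finset (List ℕ)
  | 0 => {[M]}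
  | v + 1 =>
    ((stageWords M v).biUnion (splits M)).image (fun p => p.1 ++ M :: (v + 1) :: M :: p.2) ∪
    (((stageWords M v).biUnion (splits M)).image (fun p => p.1 ++ (v + 1) :: M :: p.2) ∪
      ((stageWords M v).biUnion (splits M)).image (fun p => p.1 ++ (v + 1) :: p.2))

lemma mem_splits {M : ℕ} {t : List ℕ} {p : List ℕ × List ℕ} :
    p ∈ splits M t ↔ t = p.1 ++ M :: p.2 := by
  obtain ⟨A, B⟩ := p
  induction t generalizing A with
  | nil => simp [splits]
  | cons x t ih =>
    cases A with
    | nil =>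
      rcases eq_or_ne x M with h | h
      · simp [splits, h, eq_comm]
      · simp [splits, h]
    | cons a A =>
      by_cases h : x = M <;> simp [splits, h, ih] <;> grind

lemma straddle_cons_of_le {x y : ℕ} (h : x ≤ y) (t : List ℕ) :
    straddle x (y :: t) = straddle x t := by
  cases t <;> simp [straddle, Nat.not_lt.2 h]

lemma straddle_append_cons {x : ℕ} (A B : List ℕ) {y z : ℕ} (hy : x < y) (hz : x < z) :
    straddle x (A ++ y :: B) = straddle x (A ++ z :: B) := by
  induction A with
  | nil => simp [straddle_cons_of_le hy.le, straddle_cons_of_le hz.le]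
  | cons a A ih =>
    cases A with
    | nil => simp_all [straddle]
    | cons b A => simp_all [straddle]

lemma straddle_append_cons_cons {x : ℕ} (A B : List ℕ) {y z : ℕ} (hy : x < y) (hz : x < z) :
    straddle x (A ++ y :: z :: B) = straddle x (A ++ z :: B) := by
  induction A with
  | nil => simp [straddle_cons_of_le hy.le]
  | cons a A ih =>
    cases A with
    | nil => simp_all [straddle]
    | cons b A => simp_all [straddle]

lemma straddle_eq_zero {x : ℕ} {t : List ℕ} (h : ∀ y ∈ t, y ≤ x) : straddle x t = 0 := by
  induction t with
  | nil => rfl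
  | cons a t ih =>
    cases t with
    | nil => rfl
    | cons b t =>
      rw [straddle, ih fun y hy => h y (List.mem_cons_of_mem _ hy)]
      have := h b (by simp)
      grind

lemma straddle_eq_count {M v : ℕ} (hv : v < M) {b : ℕ} {B : List ℕ}
    (hl : ∀ y ∈ b :: B, y < v ∨ y = M) (hc : (b :: B).IsChain (fun a b => a = M → b ≠ M)) :
    straddle v (b :: B) = B.count M := by
  induction B generalizing b with
  | nil => simp [straddle]
  | cons c B ih =>
    rw [straddle, ih (fun y hy => hl y (List.mem_cons_of_mem _ hy)) hc.tail]
    have hb := hl b (by simp)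
    have hc' := hl c (by simp)
    have := (List.isChain_cons_cons.1 hc).1
    grind

/-- The replacements of the placeholder `M` by a word around the new letter `v`. -/
inductive IsReplacement (M v : ℕ) : List ℕ → Prop
  | valley : IsReplacement M v [M, v, M]
  | ascent : IsReplacement M v [v, M]
  | descent : IsReplacement M v [M, v]
  | peak : IsReplacement M v [v]

lemma IsReplacement.reverse {M v : ℕ} {r : List ℕ} (h : IsReplacement M v r) :
    IsReplacement M v r.reverse := by
  cases h <;> constructor

lemma straddle_replace {M v x : ℕ} (hv : v < M) (hx : x < v ∨ x = M) {r A B : List ℕ}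
    (h : IsReplacement M v r) (hA : ∀ y ∈ A, y ≤ M) (hB : ∀ y ∈ B, y ≤ M) :
    straddle x (A ++ r ++ B) = straddle x (A ++ M :: B) := by
  rcases hx with hx | rfl
  · have h1 := straddle_append_cons_cons (x := x) (y := M) (z := v)
    have h2 := straddle_append_cons_cons (x := x) (y := v) (z := M)
    have h3 := straddle_append_cons (x := x) (y := v) (z := M)
    cases h <;> simp <;> grind
  · rw [straddle_eq_zero, straddle_eq_zero]
    · grind
    · cases h <;> grind

lemma resList_replace {M v : ℕ} (hv : v < M) {r A B : List ℕ} (h : IsReplacement M v r)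
    (hl : ∀ y ∈ A ++ M :: B, y < v ∨ y = M)
    (hc : (A ++ M :: B).IsChain (fun a b => a = M → b ≠ M)) :
    resList (A ++ r ++ B) = resList (A ++ M :: B) + B.count M := by
  induction A with
  | nil =>
    have hle : ∀ y ∈ B, y ≤ M := fun y hy => by
      rcases hl y (by simp [hy]) with h | h <;> omega
    have hB : straddle M B = 0 := straddle_eq_zero hle
    have h1 : straddle v (M :: B) = B.count M := straddle_eq_count hv hl hc
    have h2 := straddle_cons_of_le hv.le B
    have h3 : straddle M (v :: M :: B) = 0 := straddle_eq_zero (by grind)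
    have h4 : straddle M (v :: B) = 0 := straddle_eq_zero (by grind)
    cases h <;> simp_all [resList] <;> omega
  | cons a A ih =>
    have hle : ∀ y ∈ a :: A ++ M :: B, y ≤ M := fun y hy => by
      rcases hl y hy with h | h <;> omega
    have := straddle_replace hv (hl a (by simp)) h (A := A) (B := B)
      (fun y hy => hle y (by simp [hy])) (fun y hy => hle y (by simp [hy]))
    have := ih (fun y hy => hl y (List.mem_cons_of_mem _ hy))
      (by simp only [List.cons_append] at hc; exact hc.tail)
    simp_all [resList]
    omega

lemma resList_reverse_replace {M v : ℕ} (hv : v < M) {r A B : List ℕ} (h : IsReplacement M v r)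
    (hl : ∀ y ∈ A ++ M :: B, y < v ∨ y = M)
    (hc : (A ++ M :: B).IsChain (fun a b => a = M → b ≠ M)) :
    resList (A ++ r ++ B).reverse = resList (A ++ M :: B).reverse + A.count M := by
  have := resList_replace hv h.reverse (A := B.reverse) (B := A.reverse) (by grind) (by
    have h' : (A ++ M :: B).reverse.IsChain (fun a b => a = M → b ≠ M) :=
      List.isChain_reverse.2 (hc.imp (by grind))
    simpa using h')
  simpa using this

lemma tripleCount_append (p : ℕ → ℕ → ℕ → Prop) [∀ a b c, Decidable (p a b c)]
    (A B : List ℕ) (x y : ℕ) :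
    tripleCount p (A ++ x :: y :: B) =
      tripleCount p (A ++ [x, y]) + tripleCount p (x :: y :: B) := by
  induction A with
  | nil => simp [tripleCount]
  | cons a A ih =>
    rcases A with _ | ⟨b, _ | ⟨c, A⟩⟩
    · simp [tripleCount]
    · simp [tripleCount] at ih ⊢; omega
    · simp [tripleCount] at ih ⊢; omega

lemma tripleCount_congr_last (p : ℕ → ℕ → ℕ → Prop) [∀ a b c, Decidable (p a b c)]
    (A : List ℕ) {a x y : ℕ} (h : ∀ z, p z a x ↔ p z a y) :
    tripleCount p (A ++ [a, x]) = tripleCount p (A ++ [a, y]) := by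
  induction A with
  | nil => simp [tripleCount]
  | cons b A ih =>
    rcases A with _ | ⟨c, _ | ⟨d, A⟩⟩
    · simp [tripleCount, h]
    · simp [tripleCount] at ih ⊢; omega
    · simp [tripleCount] at ih ⊢; omega

lemma tripleCount_congr_head (p : ℕ → ℕ → ℕ → Prop) [∀ a b c, Decidable (p a b c)]
    (B : List ℕ) {b x y : ℕ} (h : ∀ z, p x b z ↔ p y b z) :
    tripleCount p (x :: b :: B) = tripleCount p (y :: b :: B) := by
  cases B <;> simp [tripleCount, h]

lemma exists_borders {M v : ℕ} (hv : 0 < v) {A B : List ℕ}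
    (hl : ∀ y ∈ A ++ M :: B, y < v ∨ y = M)
    (hc : (A ++ M :: B).IsChain (fun a b => a = M → b ≠ M)) :
    ∃ A' a b B', 0 :: A = A' ++ [a] ∧ B ++ [0] = b :: B' ∧ a < v ∧ b < v := by
  have hA : ∃ A' a, 0 :: A = A' ++ [a] ∧ a < v := by
    rcases A.eq_nil_or_concat with rfl | ⟨A', a, rfl⟩
    · exact ⟨[], 0, rfl, hv⟩
    · refine ⟨0 :: A', a, by simp, (hl a (by simp)).resolve_right ?_⟩
      have h' : (A' ++ a :: M :: B).IsChain (fun a b => a = M → b ≠ M) := by simpa using hc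
      have := (List.isChain_append.1 h').2.1
      exact fun h => (List.isChain_cons_cons.1 this).1 h rfl
  have hB : ∃ b B', B ++ [0] = b :: B' ∧ b < v := by
    rcases B with _ | ⟨b, B'⟩
    · exact ⟨0, [], rfl, hv⟩
    · refine ⟨b, B' ++ [0], by simp, (hl b (by simp)).resolve_right ?_⟩
      have := (List.isChain_append.1 hc).2.1
      exact (List.isChain_cons_cons.1 this).1 rfl
  obtain ⟨A', a, h1, h2⟩ := hA
  obtain ⟨b, B', h3, h4⟩ := hB
  exact ⟨A', a, b, B', h1, h3, h2, h4⟩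

lemma valleyCount_replace {M v : ℕ} (hv : 0 < v) (hvM : v < M) {A B : List ℕ}
    (hl : ∀ y ∈ A ++ M :: B, y < v ∨ y = M)
    (hc : (A ++ M :: B).IsChain (fun a b => a = M → b ≠ M)) :
    valleyCount (A ++ M :: v :: M :: B) = valleyCount (A ++ M :: B) + 1 ∧
    valleyCount (A ++ v :: M :: B) = valleyCount (A ++ M :: B) ∧
    valleyCount (A ++ v :: B) = valleyCount (A ++ M :: B) ∧
    doubleDescentCount (A ++ M :: v :: M :: B) = doubleDescentCount (A ++ M :: B) ∧
    doubleDescentCount (A ++ v :: M :: B) = doubleDescentCount (A ++ M :: B) ∧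
    doubleDescentCount (A ++ v :: B) = doubleDescentCount (A ++ M :: B) := by
  obtain ⟨A', a, b, B', hA, hB, ha, hb⟩ := exists_borders hv hl hc
  have key (r : List ℕ) : 0 :: ((A ++ r ++ B) ++ [0]) = A' ++ a :: (r ++ b :: B') := by
    rw [← hB]
    calc _ = (0 :: A) ++ (r ++ (B ++ [0])) := by simp
      _ = _ := by rw [hA]; simp
  have k1 := key [M]
  have k2 := key [M, v, M]
  have k3 := key [v, M]
  have k4 := key [v]
  simp only [List.append_assoc, List.cons_append, List.nil_append] at k1 k2 k3 k4
  simp only [valleyCount, doubleDescentCount, List.append_assoc, List.cons_append, k1, k2, k3, k4]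
  have e1 := tripleCount_congr_last IsValley A' (a := a) (x := v) (y := M) (by grind)
  have e2 := tripleCount_congr_last IsDoubleDescent A' (a := a) (x := v) (y := M) (by grind)
  have e3 := tripleCount_congr_head IsValley B' (b := b) (x := v) (y := M) (by grind)
  have e4 := tripleCount_congr_head IsDoubleDescent B' (b := b) (x := v) (y := M) (by grind)
  rw [tripleCount_append IsValley A' (v :: M :: b :: B'),
    tripleCount_append IsValley A' (M :: b :: B'),
    tripleCount_append IsValley A' (b :: B') a M,
    tripleCount_append IsValley A' (b :: B') a v,
    tripleCount_append IsDoubleDescent A' (v :: M :: b :: B'),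
    tripleCount_append IsDoubleDescent A' (M :: b :: B'),
    tripleCount_append IsDoubleDescent A' (b :: B') a M,
    tripleCount_append IsDoubleDescent A' (b :: B') a v, e1, e2]
  simp only [tripleCount, e3, e4]
  grind

lemma IsStageWord.lt_or_eq {M v : ℕ} {t : List ℕ} (h : IsStageWord M v t) :
    ∀ y ∈ t, y < v + 1 ∨ y = M := fun y hy => by
  rcases h.letters y hy with h | h <;> omega

lemma IsStageWord.replace {M v : ℕ} (hvM : v + 1 < M) {A B : List ℕ}
    (h : IsStageWord M v (A ++ M :: B)) :
    IsStageWord M (v + 1) (A ++ M :: (v + 1) :: M :: B) ∧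
    IsStageWord M (v + 1) (A ++ (v + 1) :: M :: B) ∧
    IsStageWord M (v + 1) (A ++ (v + 1) :: B) := by
  have hd := valleyCount_replace (Nat.add_one_pos v) hvM h.lt_or_eq h.chain
  have hA : ∀ y ∈ A, (1 ≤ y ∧ y ≤ v) ∨ y = M := fun y hy => h.letters y (by simp [hy])
  have hB : ∀ y ∈ B, (1 ≤ y ∧ y ≤ v) ∨ y = M := fun y hy => h.letters y (by simp [hy])
  have hA' : ∀ y ∈ A, (1 ≤ y ∧ y ≤ v + 1) ∨ y = M := fun y hy => by have := hA y hy; omega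
  have hB' : ∀ y ∈ B, (1 ≤ y ∧ y ≤ v + 1) ∨ y = M := fun y hy => by have := hB y hy; omega
  have cA : A.count (v + 1) = 0 := List.count_eq_zero.2 fun hm => by have := hA _ hm; omega
  have cB : B.count (v + 1) = 0 := List.count_eq_zero.2 fun hm => by have := hB _ hm; omega
  have hcnt : ∀ u, 1 ≤ u → u ≤ v → A.count u + B.count u = 1 := fun u h1 h2 => by
    have := h.count_eq u h1 h2
    rw [List.count_append, List.count_cons] at this
    grind
  have hch := h.chain
  have hdd := h.noDoubleDescent
  have cc := List.isChain_append.1 hch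
  refine ⟨⟨by simp, by grind, ?_, ?_, by omega⟩, ⟨by simp, by grind, ?_, ?_, by omega⟩,
    ⟨by simp, by grind, ?_, ?_, by omega⟩⟩
  any_goals
    intro u h1 h2
    rcases eq_or_ne u (v + 1) with rfl | hu
    · simp [List.count_append, cA, cB, hvM.ne']
    · have := hcnt u h1 (by omega)
      have : M ≠ u := by omega
      simp_all [List.count_append, hu.symm]
  all_goals
    rw [List.isChain_append]
    refine ⟨cc.1, ?_, ?_⟩
    · have := cc.2.1
      cases B <;> simp_all [List.isChain_cons_cons] <;> grind
    · have := cc.2.2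
      simp_all
      try omega

lemma IsStageWord.exists_parent {M v : ℕ} (hvM : v + 1 < M) {t : List ℕ}
    (h : IsStageWord M (v + 1) t) : ∃ A B, IsStageWord M v (A ++ M :: B) ∧
      (t = A ++ M :: (v + 1) :: M :: B ∨ t = A ++ (v + 1) :: M :: B ∨ t = A ++ (v + 1) :: B) := by
  have hmem : v + 1 ∈ t := by
    rw [← List.count_pos_iff, h.count_eq _ (by omega) le_rfl]; exact one_pos
  obtain ⟨A, B, rfl⟩ := List.append_of_mem hmem
  have hcv := h.count_eq (v + 1) (by omega) le_rfl
  simp only [List.count_append, List.count_cons_self] at hcv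
  have nA : v + 1 ∉ A := List.count_eq_zero.1 (by omega)
  have nB : v + 1 ∉ B := List.count_eq_zero.1 (by omega)
  have hA : ∀ y ∈ A, (1 ≤ y ∧ y ≤ v) ∨ y = M := fun y hy => by
    have := h.letters y (by simp [hy])
    have : y ≠ v + 1 := fun h => nA (h ▸ hy)
    omega
  have hB : ∀ y ∈ B, (1 ≤ y ∧ y ≤ v) ∨ y = M := fun y hy => by
    have := h.letters y (by simp [hy])
    have : y ≠ v + 1 := fun h => nB (h ▸ hy)
    omega
  have hcnt : ∀ u, 1 ≤ u → u ≤ v → A.count u + B.count u = 1 := fun u h1 h2 => by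
    have := h.count_eq u h1 (by omega)
    rw [List.count_append, List.count_cons_of_ne (by omega)] at this
    exact this
  have main (A' B' : List ℕ) (hA' : A' = A ∨ A = A' ++ [M]) (hB' : B' = B ∨ B = M :: B')
      (hc : (A' ++ M :: B').IsChain (fun a b => a = M → b ≠ M))
      (hd : doubleDescentCount (A' ++ M :: B') = 0) : IsStageWord M v (A' ++ M :: B') := by
    refine ⟨by simp, by grind, ?_, hc, hd⟩
    intro u h1 h2
    have := hcnt u h1 h2
    have : M ≠ u := by omega
    rcases hA' with rfl | rfl <;> rcases hB' with rfl | rfl <;>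
      simp_all [List.count_append, List.count_cons]
  have lt : ∀ A' B' : List ℕ, (A' = A ∨ A = A' ++ [M]) → (B' = B ∨ B = M :: B') →
      ∀ y ∈ A' ++ M :: B', y < v + 1 ∨ y = M := by
    intro A' B' hA' hB' y hy
    have : (1 ≤ y ∧ y ≤ v) ∨ y = M := by grind
    omega
  have hdd := h.noDoubleDescent
  have cc := List.isChain_append.1 h.chain
  by_cases ha : A.getLast? = some M <;> by_cases hb : B.head? = some M
  · obtain ⟨A', rfl⟩ := List.getLast?_eq_some_iff.1 ha
    obtain ⟨B', rfl⟩ := List.head?_eq_some_iff.1 hb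
    have hc : (A' ++ M :: B').IsChain (fun a b => a = M → b ≠ M) := by
      have c1 := cc.1
      have c2 := cc.2.1
      rw [List.isChain_append] at c1
      have := c2.tail
      rw [List.isChain_append]
      exact ⟨c1.1, this, by simpa using c1.2.2⟩
    have hd := valleyCount_replace (Nat.add_one_pos v) hvM (lt A' B' (by simp) (by simp)) hc
    refine ⟨A', B', main _ _ (by simp) (by simp) hc ?_, by simp⟩
    simp at hdd hd
    omega
  · exfalso
    obtain ⟨A', rfl⟩ := List.getLast?_eq_some_iff.1 ha
    obtain ⟨b, B', hbB, hbv⟩ : ∃ b B', B ++ [0] = b :: B' ∧ b ≤ v := by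
      rcases B with _ | ⟨b, B'⟩
      · exact ⟨0, [], rfl, by omega⟩
      · refine ⟨b, B' ++ [0], rfl, ?_⟩
        have := hB b (by simp)
        simp at hb
        omega
    have e : 0 :: ((A' ++ [M] ++ (v + 1) :: B) ++ [0]) = (0 :: A') ++ M :: (v + 1) :: b :: B' := by
      rw [← hbB]; simp
    rw [doubleDescentCount, e, tripleCount_append, tripleCount, if_pos (by grind)] at hdd
    omega
  · obtain ⟨B', rfl⟩ := List.head?_eq_some_iff.1 hb
    have hc : (A ++ M :: B').IsChain (fun a b => a = M → b ≠ M) := by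
      rw [List.isChain_append]
      refine ⟨cc.1, cc.2.1.tail, ?_⟩
      intro x hx y hy hxM
      simp_all
    have hd := valleyCount_replace (Nat.add_one_pos v) hvM (lt A B' (by simp) (by simp)) hc
    exact ⟨A, B', main _ _ (by simp) (by simp) hc (by omega), by simp⟩
  · have hc : (A ++ M :: B).IsChain (fun a b => a = M → b ≠ M) := by
      rw [List.isChain_append]
      refine ⟨cc.1, ?_, ?_⟩
      · have := cc.2.1
        cases B <;> simp_all [List.isChain_cons_cons]
      · intro x hx y hy hxM
        simp_all
    have hd := valleyCount_replace (Nat.add_one_pos v) hvM (lt A B (by simp) (by simp)) hc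
    exact ⟨A, B, main _ _ (by simp) (by simp) hc (by omega), by simp⟩

lemma isStageWord_zero {M : ℕ} {t : List ℕ} : IsStageWord M 0 t ↔ t = [M] := by
  constructor
  · intro h
    have hl : ∀ x ∈ t, x = M := fun x hx => by have := h.letters x hx; omega
    rcases t with _ | ⟨a, _ | ⟨b, t⟩⟩
    · exact absurd rfl h.ne_nil
    · rw [hl a (by simp)]
    · exact absurd (hl b (by simp)) ((List.isChain_cons_cons.1 h.chain).1 (hl a (by simp)))
  · rintro rfl
    exact ⟨by simp, by simp, by omega, by simp, by simp [doubleDescentCount, tripleCount]⟩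

lemma mem_biUnion_splits {M : ℕ} {S : Finset (List ℕ)} {p : List ℕ × List ℕ} :
    p ∈ S.biUnion (splits M) ↔ p.1 ++ M :: p.2 ∈ S := by
  simp [mem_splits]

lemma mem_stageWords {M v : ℕ} (hv : v < M) {t : List ℕ} :
    t ∈ stageWords M v ↔ IsStageWord M v t := by
  induction v generalizing t with
  | zero => rw [isStageWord_zero]; simp [stageWords]
  | succ v ih =>
    have ih {t} := ih (by omega) (t := t)
    simp only [stageWords, Finset.mem_union, Finset.mem_image, mem_biUnion_splits, ih]
    constructor
    · rintro (⟨p, hp, rfl⟩ | ⟨p, hp, rfl⟩ | ⟨p, hp, rfl⟩)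
      · exact (hp.replace hv).1
      · exact (hp.replace hv).2.1
      · exact (hp.replace hv).2.2
    · intro h
      obtain ⟨A, B, hAB, h1 | h1 | h1⟩ := h.exists_parent hv
      · exact Or.inl ⟨(A, B), hAB, h1.symm⟩
      · exact Or.inr (Or.inl ⟨(A, B), hAB, h1.symm⟩)
      · exact Or.inr (Or.inr ⟨(A, B), hAB, h1.symm⟩)

lemma eq_and_eq_of_append_cons {α : Type*} {c : α} {A B A' B' : List α} (hA : c ∉ A) (hB : c ∉ B)
    (h : A ++ c :: B = A' ++ c :: B') : A = A' ∧ B = B' :=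
  ((List.append_cons_inj_of_notMem hA hB).1 h).imp_right And.right

lemma sum_stageWords_succ {R : Type*} [AddCommMonoid R] {M v : ℕ} (hv : v + 1 < M)
    (f : List ℕ → R) :
    ∑ t ∈ stageWords M (v + 1), f t = ∑ t ∈ stageWords M v, ∑ p ∈ splits M t,
      (f (p.1 ++ M :: (v + 1) :: M :: p.2) + f (p.1 ++ (v + 1) :: M :: p.2) +
        f (p.1 ++ (v + 1) :: p.2)) := by
  have hQ {p : List ℕ × List ℕ} (hp : p ∈ (stageWords M v).biUnion (splits M)) :
      v + 1 ∉ p.1 ∧ v + 1 ∉ p.2 ∧ (∀ A', p.1 ≠ A' ++ [M]) ∧ ∀ B', p.2 ≠ M :: B' := by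
    rw [mem_biUnion_splits, mem_stageWords (by omega)] at hp
    have hl : ∀ y ∈ p.1 ++ M :: p.2, y ≠ v + 1 := fun y hy => by
      have := hp.letters y hy; omega
    have hc := List.isChain_append.1 hp.chain
    refine ⟨fun h => hl _ (by simp [h]) rfl, fun h => hl _ (by simp [h]) rfl, ?_, ?_⟩
    · intro A' h
      have := hc.2.2
      simp [h] at this
    · intro B' h
      have := hc.2.1
      simp [h] at this
  rw [stageWords, Finset.sum_union, Finset.sum_union, Finset.sum_image, Finset.sum_image,
    Finset.sum_image, ← add_assoc, ← Finset.sum_add_distrib, ← Finset.sum_add_distrib,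
    Finset.sum_biUnion]
  · intro t _ t' _ h
    rw [Function.onFun, Finset.disjoint_left]
    intro p hp hp'
    rw [mem_splits] at hp hp'
    exact h (hp.trans hp'.symm)
  · intro p hp q hq h
    have hp := hQ hp
    have := eq_and_eq_of_append_cons hp.1 hp.2.1 h
    exact Prod.ext this.1 this.2
  · intro p hp q hq h
    have hp := hQ hp
    have := eq_and_eq_of_append_cons hp.1 (by simp [hp.2.1]; omega) h
    exact Prod.ext this.1 (by simpa using this.2)
  · intro p hp q hq h
    have hp := hQ hp
    have h' : (p.1 ++ [M]) ++ (v + 1) :: M :: p.2 = (q.1 ++ [M]) ++ (v + 1) :: M :: q.2 := by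
      simpa using h
    have := eq_and_eq_of_append_cons (by simp [hp.1]; omega) (by simp [hp.2.1]; omega) h'
    exact Prod.ext (by simpa using this.1) (by simpa using this.2)
  · rw [Finset.disjoint_left]
    intro t ht ht'
    obtain ⟨p, hp, rfl⟩ := Finset.mem_image.1 ht
    obtain ⟨q, hq, h⟩ := Finset.mem_image.1 ht'
    have hq := hQ hq
    exact hq.2.2.2 _ (eq_and_eq_of_append_cons hq.1 hq.2.1 h).2
  · rw [Finset.disjoint_left]
    intro t ht ht'
    obtain ⟨p, hp, rfl⟩ := Finset.mem_image.1 ht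
    have e : p.1 ++ M :: (v + 1) :: M :: p.2 = (p.1 ++ [M]) ++ (v + 1) :: M :: p.2 := by simp
    simp only [e] at ht'
    rcases Finset.mem_union.1 ht' with ht' | ht'
    · obtain ⟨q, hq, h⟩ := Finset.mem_image.1 ht'
      have hq := hQ hq
      exact hq.2.2.1 _ (eq_and_eq_of_append_cons hq.1 (by simp [hq.2.1]; omega) h).1
    · obtain ⟨q, hq, h⟩ := Finset.mem_image.1 ht'
      have hq := hQ hq
      exact hq.2.2.1 _ (eq_and_eq_of_append_cons hq.1 hq.2.1 h).1

/-- The generating polynomial `∑_{g < s} q ^ (2 * (s - 1 - g) + g)` of the choices of one among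
`s` placeholders. -/
noncomputable def stepWeight : ℕ → Polynomial ℤ
  | 0 => 0
  | s + 1 => Polynomial.X ^ (2 * s) + Polynomial.X * stepWeight s

lemma sum_splits (M : ℕ) (t : List ℕ) :
    ∑ p ∈ splits M t, (Polynomial.X : Polynomial ℤ) ^ (2 * p.2.count M + p.1.count M) =
      stepWeight (t.count M) := by
  induction t with
  | nil => simp [splits, stepWeight]
  | cons x t ih =>
    have hinj : Set.InjOn (fun p : List ℕ × List ℕ => (x :: p.1, p.2)) (splits M t) := by
      rintro ⟨a, b⟩ _ ⟨c, d⟩ _ h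
      simpa using h
    rw [splits, Finset.sum_union, Finset.sum_image hinj]
    · rcases eq_or_ne x M with rfl | h
      · simp [stepWeight, ← ih, Finset.mul_sum, ← pow_succ', add_assoc]
      · simp [h, ih]
    · rw [Finset.disjoint_left]
      intro p hp hp'
      obtain ⟨q, -, rfl⟩ := Finset.mem_image.1 hp'
      split_ifs at hp <;> simp at hp

lemma dvd_stepWeight_two_mul (m : ℕ) :
    (Polynomial.X * (1 + Polynomial.X) : Polynomial ℤ) ∣ stepWeight (2 * m) := by
  induction m with
  | zero => simp [stepWeight]
  | succ m ih =>
    obtain ⟨c, hc⟩ := ih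
    refine ⟨Polynomial.X ^ (4 * m) + Polynomial.X ^ 2 * c, ?_⟩
    rw [show 2 * (m + 1) = 2 * m + 1 + 1 by ring, stepWeight, stepWeight, hc]
    ring

lemma dvd_stepWeight_mul (s : ℕ) :
    (Polynomial.X * (1 + Polynomial.X) : Polynomial ℤ) ∣ stepWeight s * stepWeight (s + 1) := by
  obtain ⟨m, rfl | rfl⟩ := s.even_or_odd'
  · exact (dvd_stepWeight_two_mul m).mul_right _
  · exact (dvd_stepWeight_two_mul (m + 1)).mul_left _

/-- Generating polynomial of the stage words with `s` placeholders and `k` valleys. -/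
noncomputable def stagePoly (M v s k : ℕ) : Polynomial ℤ :=
  ∑ t ∈ stageWords M v, if t.count M = s ∧ valleyCount t = k then
    Polynomial.X ^ (2 * resList t + resList t.reverse) else 0

lemma stagePoly_succ {M v : ℕ} (hv : v + 1 < M) (s k : ℕ) :
    stagePoly M (v + 1) s k =
      (if 1 ≤ s ∧ 1 ≤ k then stagePoly M v (s - 1) (k - 1) * stepWeight (s - 1) else 0) +
      stagePoly M v s k * stepWeight s + stagePoly M v (s + 1) k * stepWeight (s + 1) := by
  have h1 : ∀ s' k', stagePoly M v s' k' * stepWeight s' =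
      ∑ t ∈ stageWords M v, ∑ p ∈ splits M t, if t.count M = s' ∧ valleyCount t = k' then
        Polynomial.X ^ (2 * resList t + resList t.reverse) *
          Polynomial.X ^ (2 * p.2.count M + p.1.count M) else 0 := by
    intro s' k'
    rw [stagePoly, Finset.sum_mul]
    refine Finset.sum_congr rfl fun t _ => ?_
    split_ifs with h
    · rw [← Finset.mul_sum, sum_splits, h.1]
    · simp
  have h2 : (if 1 ≤ s ∧ 1 ≤ k then stagePoly M v (s - 1) (k - 1) * stepWeight (s - 1) else 0) =
      ∑ t ∈ stageWords M v, ∑ p ∈ splits M t, if t.count M + 1 = s ∧ valleyCount t + 1 = k then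
        (Polynomial.X : Polynomial ℤ) ^ (2 * resList t + resList t.reverse) *
          Polynomial.X ^ (2 * p.2.count M + p.1.count M) else 0 := by
    split_ifs with h
    · rw [h1]
      refine Finset.sum_congr rfl fun t _ => Finset.sum_congr rfl fun p _ => ?_
      congr 1
      grind
    · refine (Finset.sum_eq_zero fun t _ => Finset.sum_eq_zero fun p _ => if_neg ?_).symm
      omega
  rw [h2, h1, h1, stagePoly, sum_stageWords_succ hv]
  simp only [← Finset.sum_add_distrib]
  refine Finset.sum_congr rfl fun t ht => Finset.sum_congr rfl fun p hp => ?_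
  obtain ⟨A, B⟩ := p
  obtain rfl := mem_splits.1 hp
  have hw := (mem_stageWords (by omega)).1 ht
  have hV := valleyCount_replace (Nat.add_one_pos v) hv hw.lt_or_eq hw.chain
  have key {r : List ℕ} (hr : IsReplacement M (v + 1) r) :
      (Polynomial.X : Polynomial ℤ) ^ (2 * resList (A ++ r ++ B) + resList (A ++ r ++ B).reverse) =
      Polynomial.X ^ (2 * resList (A ++ M :: B) + resList (A ++ M :: B).reverse) *
        Polynomial.X ^ (2 * B.count M + A.count M) := by
    rw [resList_replace hv hr hw.lt_or_eq hw.chain,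
      resList_reverse_replace hv hr hw.lt_or_eq hw.chain, ← pow_add]
    ring
  have k1 := key .valley
  have k2 := key .ascent
  have k3 := key .peak
  simp only [List.append_assoc, List.cons_append, List.nil_append] at k1 k2 k3
  simp only [k1, k2, k3, hV.1, hV.2.1, hV.2.2.1, List.count_append, List.count_cons_self,
    List.count_cons_of_ne (show v + 1 ≠ M by omega)]
  congr 3
  grind

lemma dvd_stagePoly {M v : ℕ} (hv : v < M) (s k : ℕ) :
    (∏ i ∈ Finset.Ico 1 s, stepWeight i) * (Polynomial.X * (1 + Polynomial.X)) ^ (k - (s - 1)) ∣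
      stagePoly M v s k := by
  induction v generalizing s k with
  | zero =>
    simp only [stagePoly, stageWords, Finset.sum_singleton]
    split_ifs with h
    · obtain ⟨rfl, rfl⟩ := h
      simp [valleyCount, tripleCount]
    · exact dvd_zero _
  | succ v ih =>
    have ih := ih (by omega)
    rw [stagePoly_succ hv]
    refine dvd_add (dvd_add ?_ ((ih s k).mul_right _)) ?_
    · split_ifs with h
      · obtain ⟨_ | s, rfl⟩ := Nat.exists_eq_add_of_le' h.1
        · simp [stepWeight]
        obtain ⟨k, rfl⟩ := Nat.exists_eq_add_of_le' h.2
        have := mul_dvd_mul_right (ih (s + 1) k) (stepWeight (s + 1))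
        rw [mul_right_comm, ← Finset.prod_Ico_succ_top (by omega)] at this
        convert this using 3 <;> omega
      · exact dvd_zero _
    · refine dvd_trans ?_ (mul_dvd_mul_right (ih (s + 1) k) (stepWeight (s + 1)))
      rcases s with _ | s
      · simp
      rw [Finset.prod_Ico_succ_top (show 1 ≤ s + 1 by omega)]
      generalize ∏ i ∈ Finset.Ico 1 (s + 1), stepWeight i = P
      have e : k - (s + 1 - 1) ≤ (k - (s + 1 + 1 - 1)) + 1 := by omega
      calc _ ∣ P * (Polynomial.X * (1 + Polynomial.X)) ^ ((k - (s + 1 + 1 - 1)) + 1) :=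
            mul_dvd_mul_left _ (pow_dvd_pow _ e)
        _ = P * (Polynomial.X * (1 + Polynomial.X)) ^ (k - (s + 1 + 1 - 1)) *
            (Polynomial.X * (1 + Polynomial.X)) := by rw [pow_succ, mul_assoc]
        _ ∣ P * (Polynomial.X * (1 + Polynomial.X)) ^ (k - (s + 1 + 1 - 1)) *
            (stepWeight (s + 1) * stepWeight (s + 1 + 1)) :=
          mul_dvd_mul_left _ (dvd_stepWeight_mul _)
        _ = _ := by
          generalize (Polynomial.X * (1 + Polynomial.X) : Polynomial ℤ) ^ (k - (s + 1 + 1 - 1)) = Q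
          ring

lemma map_range_succ (f : ℕ → ℕ) (n : ℕ) :
    (List.range (n + 1)).map f = f 0 :: (List.range n).map (fun i => f (i + 1)) := by
  rw [List.range_succ_eq_map]
  simp [Function.comp_def]

lemma straddle_map_range (x : ℕ) (f : ℕ → ℕ) (n : ℕ) :
    straddle x ((List.range (n + 1)).map f) =
      ∑ j ∈ Finset.range n, if f j < x ∧ x < f (j + 1) then 1 else 0 := by
  induction n generalizing f with
  | zero => simp [straddle]
  | succ n ih =>
    have := ih (fun i => f (i + 1))
    rw [map_range_succ] at this
    rw [map_range_succ, map_range_succ, straddle, this, Finset.sum_range_succ', add_comm]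

lemma resList_map_range (f : ℕ → ℕ) (n : ℕ) :
    resList ((List.range (n + 1)).map f) =
      ∑ i ∈ Finset.range (n + 1), ∑ j ∈ Finset.range n,
        if i < j ∧ f j < f i ∧ f i < f (j + 1) then 1 else 0 := by
  induction n generalizing f with
  | zero => simp [resList, straddle]
  | succ n ih =>
    rw [map_range_succ, resList, straddle_map_range, ih, Finset.sum_range_succ' _ (n + 1), add_comm]
    congr 1
    · refine Finset.sum_congr rfl fun i _ => ?_
      rw [Finset.sum_range_succ']
      simp
    · rw [Finset.sum_range_succ']
      simp

lemma tripleCount_map_range (p : ℕ → ℕ → ℕ → Prop) [∀ a b c, Decidable (p a b c)]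
    (f : ℕ → ℕ) (n : ℕ) : tripleCount p ((List.range (n + 2)).map f) =
      ∑ i ∈ Finset.range n, if p (f i) (f (i + 1)) (f (i + 2)) then 1 else 0 := by
  induction n generalizing f with
  | zero => simp [List.range_succ, tripleCount]
  | succ n ih =>
    have := ih (fun i => f (i + 1))
    rw [map_range_succ, map_range_succ] at this
    rw [map_range_succ, map_range_succ, map_range_succ, tripleCount, this,
      Finset.sum_range_succ', add_comm]

/-- The one-line notation of a permutation. -/
def permWord (n : ℕ) (σ : Equiv.Perm (Fin n)) : List ℕ :=
  (List.range n).map (fun i => pval n σ (i + 1))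

lemma permWord_eq_ofFn (n : ℕ) (σ : Equiv.Perm (Fin n)) :
    permWord n σ = List.ofFn (fun i => (σ i : ℕ) + 1) := by
  apply List.ext_getElem
  · simp [permWord]
  · intro i h1 h2
    have : i < n := by simpa using h2
    simp [permWord, pval, this]

lemma resList_permWord (n : ℕ) (σ : Equiv.Perm (Fin n)) : resList (permWord n σ) = res n σ := by
  rcases n with _ | n
  · rfl
  rw [permWord, resList_map_range, ← Finset.sum_product', ← Finset.card_filter, res]
  refine Finset.card_nbij' (fun p => (p.1 + 1, p.2 + 1)) (fun p => (p.1 - 1, p.2 - 1)) ?_ ?_ ?_ ?_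
  · rintro ⟨i, j⟩ h
    simp at h ⊢
    omega
  · rintro ⟨i, j⟩ h
    simp at h ⊢
    obtain ⟨⟨⟨h1, h2⟩, h3, h4⟩, h5, h6, h7⟩ := h
    rw [show i - 1 + 1 = i by omega, show j - 1 + 1 = j by omega]
    exact ⟨by omega, by omega, h6, h7⟩
  · rintro ⟨i, j⟩ h
    simp
  · rintro ⟨i, j⟩ h
    simp at h ⊢
    omega

lemma reverse_permWord (n : ℕ) (σ : Equiv.Perm (Fin n)) :
    (permWord n σ).reverse = (List.range n).map (fun i => pval n σ (n - i)) := by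
  apply List.ext_getElem
  · simp [permWord]
  · intro i h1 h2
    have : i < n := by simpa using h2
    simp only [permWord, List.getElem_reverse, List.getElem_map, List.getElem_range,
      List.length_map, List.length_range]
    congr 1
    omega

lemma resList_reverse_permWord (n : ℕ) (σ : Equiv.Perm (Fin n)) :
    resList (permWord n σ).reverse = les n σ := by
  rcases n with _ | n
  · rfl
  rw [reverse_permWord, resList_map_range, ← Finset.sum_product', ← Finset.card_filter, les]
  refine Finset.card_nbij' (fun p => (n + 1 - p.2, n + 1 - p.1))
    (fun p => (n + 1 - p.2, n + 1 - p.1)) ?_ ?_ ?_ ?_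
  · rintro ⟨i, j⟩ h
    simp at h ⊢
    obtain ⟨⟨h1, h2⟩, h5, h6, h7⟩ := h
    rw [show n + 1 - j - 1 = n - j by omega]
    exact ⟨by omega, by omega, h7, h6⟩
  · rintro ⟨i, j⟩ h
    simp at h ⊢
    obtain ⟨⟨⟨h1, h2⟩, h3, h4⟩, h5, h6, h7⟩ := h
    rw [show n + 1 - (n + 1 - i) = i by omega, show n + 1 - (n + 1 - j) = j by omega,
      show n - (n + 1 - i) = i - 1 by omega]
    exact ⟨by omega, by omega, h7, h6⟩
  · rintro ⟨i, j⟩ h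
    simp at h ⊢
    omega
  · rintro ⟨i, j⟩ h
    simp at h ⊢
    omega

lemma tripleCount_permWord (p : ℕ → ℕ → ℕ → Prop) [∀ a b c, Decidable (p a b c)]
    (n : ℕ) (σ : Equiv.Perm (Fin n)) : tripleCount p (0 :: (permWord n σ ++ [0])) =
      ((Finset.Icc 1 n).filter
        (fun i => p (pval n σ (i - 1)) (pval n σ i) (pval n σ (i + 1)))).card := by
  have h : 0 :: (permWord n σ ++ [0]) = (List.range (n + 2)).map (pval n σ) := by
    rw [map_range_succ, List.range_succ, List.map_append]
    simp [permWord, pval]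
  rw [h, tripleCount_map_range, ← Finset.card_filter]
  refine Finset.card_nbij' (· + 1) (· - 1) ?_ ?_ ?_ ?_
  · intro i h
    simp at h ⊢
    exact ⟨by omega, h.2⟩
  · intro i h
    simp at h ⊢
    obtain ⟨h1, h2⟩ := h
    rw [show i - 1 + 1 = i by omega, show i - 1 + 2 = i + 1 by omega]
    exact ⟨by omega, h2⟩
  · intro i h
    simp
  · intro i h
    simp at h ⊢
    omega

lemma valleyCount_permWord (n : ℕ) (σ : Equiv.Perm (Fin n)) :
    valleyCount (permWord n σ) = valleys n σ := tripleCount_permWord _ n σ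

lemma doubleDescentCount_permWord (n : ℕ) (σ : Equiv.Perm (Fin n)) :
    doubleDescentCount (permWord n σ) = ddes n σ := tripleCount_permWord _ n σ

lemma permWord_injective (n : ℕ) : Function.Injective (permWord n) := by
  intro σ τ h
  rw [permWord_eq_ofFn, permWord_eq_ofFn] at h
  have := List.ofFn_injective h
  ext i
  simpa using congrFun this i

lemma mem_permWord {n : ℕ} {σ : Equiv.Perm (Fin n)} {x : ℕ} :
    x ∈ permWord n σ ↔ 1 ≤ x ∧ x ≤ n := by
  rw [permWord_eq_ofFn, List.mem_ofFn]
  constructor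
  · rintro ⟨i, rfl⟩
    have := (σ i).isLt
    simp
  · rintro ⟨h1, h2⟩
    exact ⟨σ.symm ⟨x - 1, by omega⟩, by simp; omega⟩

lemma nodup_permWord (n : ℕ) (σ : Equiv.Perm (Fin n)) : (permWord n σ).Nodup := by
  rw [permWord_eq_ofFn, List.nodup_ofFn]
  intro i j h
  simpa [Fin.val_inj] using h

lemma exists_permWord_eq {n : ℕ} {t : List ℕ} (hnd : t.Nodup)
    (hm : ∀ x, x ∈ t ↔ 1 ≤ x ∧ x ≤ n) : ∃ σ, permWord n σ = t := by
  have hp : (permWord n 1).Perm t :=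
    (List.perm_ext_iff_of_nodup (nodup_permWord n 1) hnd).2 fun x => by rw [hm, mem_permWord]
  have hlen : t.length = n := by rw [← hp.length_eq]; simp [permWord]
  have hlt (i : Fin n) : (i : ℕ) < t.length := by omega
  have hb (i : Fin n) : 1 ≤ t[(i : ℕ)]'(hlt i) ∧ t[(i : ℕ)]'(hlt i) ≤ n :=
    (hm _).1 (List.getElem_mem _)
  let f : Fin n → Fin n := fun i => ⟨t[(i : ℕ)]'(hlt i) - 1, by have := hb i; omega⟩
  have hf : Function.Injective f := by
    intro i j h
    have h1 := hb i
    have h2 := hb j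
    have h : t[(i : ℕ)]'(hlt i) - 1 = t[(j : ℕ)]'(hlt j) - 1 := congrArg Fin.val h
    exact Fin.ext ((hnd.getElem_inj_iff).1 (by omega))
  refine ⟨Equiv.ofBijective f (Finite.injective_iff_bijective.1 hf), ?_⟩
  rw [permWord_eq_ofFn]
  apply List.ext_getElem
  · simp [hlen]
  · intro i h1 h2
    have := hb ⟨i, by omega⟩
    simp [f] at this ⊢
    omega

lemma isStageWord_permWord {n : ℕ} (hn : 0 < n) {σ : Equiv.Perm (Fin n)} (h : ddes n σ = 0) :
    IsStageWord (n + 1) n (permWord n σ) where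
  ne_nil := List.ne_nil_of_mem (mem_permWord.2 ⟨le_rfl, hn⟩)
  letters x hx := Or.inl (mem_permWord.1 hx)
  count_eq u h1 h2 := List.count_eq_one_of_mem (nodup_permWord n σ) (mem_permWord.2 ⟨h1, h2⟩)
  chain := by
    refine (List.pairwise_of_forall_mem_list fun a ha b _ h => ?_).isChain
    have := mem_permWord.1 ha
    omega
  noDoubleDescent := by rw [doubleDescentCount_permWord, h]

lemma sum_Snk {n : ℕ} (hn : 0 < n) (k : ℕ) :
    ∑ σ ∈ Snk n k, (Polynomial.X : Polynomial ℤ) ^ (2 * res n σ + les n σ) =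
      stagePoly (n + 1) n 0 k := by
  rw [stagePoly, ← Finset.sum_filter]
  refine Finset.sum_bij (fun σ _ => permWord n σ) ?_ ?_ ?_ ?_
  · intro σ hσ
    simp only [Snk, Finset.mem_filter, Finset.mem_univ, true_and] at hσ
    rw [Finset.mem_filter, mem_stageWords (by omega), valleyCount_permWord]
    refine ⟨isStageWord_permWord hn hσ.2, List.count_eq_zero.2 fun h => ?_, hσ.1⟩
    have := mem_permWord.1 h
    omega
  · exact fun σ _ τ _ h => permWord_injective n h
  · intro t ht
    rw [Finset.mem_filter, mem_stageWords (by omega)] at ht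
    obtain ⟨hw, h0, hk⟩ := ht
    have hM := List.count_eq_zero.1 h0
    have hm : ∀ x, x ∈ t ↔ 1 ≤ x ∧ x ≤ n := fun x =>
      ⟨fun hx => (hw.letters x hx).resolve_right fun h => hM (h ▸ hx), fun hx =>
        List.count_pos_iff.1 (by rw [hw.count_eq x hx.1 hx.2]; exact one_pos)⟩
    have hnd : t.Nodup := List.nodup_iff_count_le_one.2 fun x => by
      by_cases hx : x ∈ t
      · exact (hw.count_eq x ((hm x).1 hx).1 ((hm x).1 hx).2).le
      · simp [List.count_eq_zero.2 hx]
    obtain ⟨σ, rfl⟩ := exists_permWord_eq hnd hm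
    refine ⟨σ, ?_, rfl⟩
    simp only [Snk, Finset.mem_filter, Finset.mem_univ, true_and]
    rw [← valleyCount_permWord, ← doubleDescentCount_permWord]
    exact ⟨hk, hw.noDoubleDescent⟩
  · intro σ _
    rw [resList_permWord, resList_reverse_permWord]

/-- `γ_{n,k}(q) = Σ_{σ ∈ S_{n,k}} q^(2·res σ + les σ)` is divisible by
`q^k (1+q)^k` in `ℤ[q]`. -/
theorem statement2 (n k : ℕ) (hn : 0 < n) (hk : k ≤ (n - 1) / 2) :
    (Polynomial.X : Polynomial ℤ) ^ k * (1 + Polynomial.X) ^ k ∣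
      ∑ σ ∈ Snk n k, (Polynomial.X : Polynomial ℤ) ^ (2 * res n σ + les n σ) := by
  rw [sum_Snk hn, ← mul_pow]
  simpa using dvd_stagePoly (Nat.lt_add_one n) 0 k
end

section
/- For every positive integer n, the generalized Eulerian polynomial A_n(p,q,t) = Σ_{σ ∈ S_n} p^{res σ} q^{les σ} t^{des σ} satisfies the expansion A_n(p,q,t) = Σ_{k=0}^{⌊(n-1)/2⌋} a_{n,k}(p,q) · t^k · (1+t)^{n-1-2k}, where a_{n,k}(p,q) = Σ_{σ ∈ S_{n,k}} p^{res σ} q^{les σ}. -/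
open Finset MvPolynomial

/-- `g` is obtained from the word `f` by moving the letter `x`, which sits at position `i`
directly after the maximal factor at positions `a, …, i - 1` of letters larger than `x`,
to the front of that factor. -/
structure HopsTo (f g : ℕ → ℕ) (x a i : ℕ) : Prop where
  one_le : 1 ≤ a
  lt : a < i
  source : f i = x
  large : ∀ j, a ≤ j → j < i → x < f j
  left_lt : f (a - 1) < x
  right_lt : f (i + 1) < x
  target : g a = x
  shift : ∀ j, a ≤ j → j < i → g (j + 1) = f j
  eq_left : ∀ j, j < a → g j = f j
  eq_right : ∀ j, i < j → g j = f j

namespace HopsTo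

variable {f g : ℕ → ℕ} {x a i n : ℕ}

lemma eq_pred (h : HopsTo f g x a i) {j : ℕ} (haj : a < j) (hji : j ≤ i) :
    g j = f (j - 1) := by
  have := h.shift (j - 1) (by omega) (by omega)
  rwa [Nat.sub_add_cancel (by omega)] at this

lemma eq_of_target (h : HopsTo f g x a i) (hinj : ∀ j, f j = x → j = i) {j : ℕ}
    (hj : g j = x) : j = a := by
  have hai := h.lt
  rcases lt_trichotomy j a with hja | hja | hja
  · rw [h.eq_left j hja] at hj
    have := hinj _ hj
    omega
  · exact hja
  · by_cases hji : j ≤ i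
    · rw [h.eq_pred hja hji] at hj
      have := hinj _ hj
      omega
    · rw [h.eq_right j (by omega)] at hj
      have := hinj _ hj
      omega

lemma card_les (h : HopsTo f g x a i) (hin : i ≤ n) (hinj : ∀ j, f j = x → j = i) :
    ((Icc 2 n ×ˢ Icc 2 n).filter
      (fun p => p.1 < p.2 ∧ f p.2 < f (p.1 - 1) ∧ f p.1 < f p.2)).card =
    ((Icc 2 n ×ˢ Icc 2 n).filter
      (fun p => p.1 < p.2 ∧ g p.2 < g (p.1 - 1) ∧ g p.1 < g p.2)).card := by
  have h8' : ∀ j, a < j → j ≤ i → g j = f (j - 1) := fun j => h.eq_pred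
  have hinj' : ∀ j, g j = x → j = a := fun j => h.eq_of_target hinj
  obtain ⟨h1, h2, h3, h4, h5, h6, h7, -, h9, h10⟩ := h
  refine card_nbij'
    (fun p => (if x < f p.2 ∧ a ≤ p.1 ∧ p.1 ≤ i then p.1 + 1 else p.1,
      if p.2 = i then a else if a ≤ p.2 ∧ p.2 < i then p.2 + 1 else p.2))
    (fun p => (if x < g p.2 ∧ a + 1 ≤ p.1 ∧ p.1 ≤ i + 1 then p.1 - 1 else p.1,
      if p.2 = a then i else if a < p.2 ∧ p.2 ≤ i then p.2 - 1 else p.2)) ?_ ?_ ?_ ?_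
  · rintro ⟨k, j⟩ hkj
    simp only [coe_filter, mem_product, mem_Icc, Set.mem_ofPred_eq] at hkj ⊢
    have a1 := h4 (k - 1); have a2 := h4 k; have a3 := h4 j; have a4 := h4 (k - 1 - 1)
    have b1 := h8' (k - 1); have b2 := h8' k; have b3 := h8' (k + 1); have b4 := h8' (j + 1)
    have c1 := h9 (k - 1); have c2 := h9 k; have c3 := h9 j
    have d1 := h10 (k - 1); have d2 := h10 k; have d3 := h10 (k + 1); have d4 := h10 j
    have e1 := hinj j
    simp only [Nat.add_sub_cancel] at b3 b4
    clear h4 h8' h9 h10 hinj hinj'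
    split_ifs <;> try simp only [Nat.add_sub_cancel]
    all_goals grind
  · rintro ⟨k, j⟩ hkj
    simp only [coe_filter, mem_product, mem_Icc, Set.mem_ofPred_eq] at hkj ⊢
    have a1 := h4 (k - 1); have a2 := h4 (k - 1 - 1); have a3 := h4 (j - 1)
    have b1 := h8' (k - 1); have b2 := h8' k; have b4 := h8' j
    have c1 := h9 (k - 1); have c2 := h9 k; have c3 := h9 j
    have d1 := h10 (k - 1); have d2 := h10 k; have d4 := h10 j
    have e1 := hinj' j
    clear h4 h8' h9 h10 hinj hinj'
    split_ifs
    all_goals grind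
  · rintro ⟨k, j⟩ hkj
    simp only [coe_filter, mem_product, mem_Icc, Set.mem_ofPred_eq] at hkj ⊢
    have a1 := h4 (k - 1); have a2 := h4 k; have a3 := h4 j; have a4 := h4 (k - 1 - 1)
    have b1 := h8' (k - 1); have b2 := h8' k; have b3 := h8' (k + 1); have b4 := h8' (j + 1)
    have c1 := h9 (k - 1); have c2 := h9 k; have c3 := h9 j
    have d1 := h10 (k - 1); have d2 := h10 k; have d3 := h10 (k + 1); have d4 := h10 j
    have e1 := hinj j
    simp only [Nat.add_sub_cancel] at b3 b4
    clear h4 h8' h9 h10 hinj hinj'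
    split_ifs <;> try simp only [Nat.add_sub_cancel]
    all_goals grind
  · rintro ⟨k, j⟩ hkj
    simp only [coe_filter, mem_product, mem_Icc, Set.mem_ofPred_eq] at hkj ⊢
    have a1 := h4 (k - 1); have a2 := h4 (k - 1 - 1); have a3 := h4 (j - 1)
    have b1 := h8' (k - 1); have b2 := h8' k; have b4 := h8' j
    have c1 := h9 (k - 1); have c2 := h9 k; have c3 := h9 j
    have d1 := h10 (k - 1); have d2 := h10 k; have d4 := h10 j
    have e1 := hinj' j
    clear h4 h8' h9 h10 hinj hinj'
    split_ifs
    all_goals grind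

lemma card_res (h : HopsTo f g x a i) (hin : i ≤ n) (hinj : ∀ j, f j = x → j = i) :
    ((Icc 1 (n - 1) ×ˢ Icc 1 (n - 1)).filter
      (fun p => p.1 < p.2 ∧ f p.2 < f p.1 ∧ f p.1 < f (p.2 + 1))).card =
    ((Icc 1 (n - 1) ×ˢ Icc 1 (n - 1)).filter
      (fun p => p.1 < p.2 ∧ g p.2 < g p.1 ∧ g p.1 < g (p.2 + 1))).card := by
  have h8' : ∀ j, a < j → j ≤ i → g j = f (j - 1) := fun j => h.eq_pred
  have hinj' : ∀ j, g j = x → j = a := fun j => h.eq_of_target hinj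
  obtain ⟨h1, h2, h3, h4, h5, h6, h7, -, h9, h10⟩ := h
  refine card_nbij'
    (fun p => (if p.1 = i then a else if a ≤ p.1 ∧ p.1 < i then p.1 + 1 else p.1,
      if x < f p.1 ∧ a ≤ p.2 + 1 ∧ p.2 < i then p.2 + 1 else p.2))
    (fun p => (if p.1 = a then i else if a < p.1 ∧ p.1 ≤ i then p.1 - 1 else p.1,
      if x < g p.1 ∧ a ≤ p.2 ∧ p.2 ≤ i then p.2 - 1 else p.2)) ?_ ?_ ?_ ?_
  · rintro ⟨j, k⟩ hkj
    simp only [coe_filter, mem_product, mem_Icc, Set.mem_ofPred_eq] at hkj ⊢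
    have a1 := h4 (k + 1); have a2 := h4 k; have a3 := h4 j
    have b1 := h8' (k + 1); have b2 := h8' k; have b3 := h8' (k + 1 + 1); have b4 := h8' (j + 1)
    have c1 := h9 (k + 1); have c2 := h9 k; have c3 := h9 j
    have d1 := h10 (k + 1); have d2 := h10 k; have d3 := h10 (k + 1 + 1); have d4 := h10 j
    have e1 := hinj j
    simp only [Nat.add_sub_cancel] at b1 b3 b4
    clear h4 h8' h9 h10 hinj hinj'
    split_ifs <;> try simp only [Nat.add_sub_cancel]
    all_goals grind
  · rintro ⟨j, k⟩ hkj
    simp only [coe_filter, mem_product, mem_Icc, Set.mem_ofPred_eq] at hkj ⊢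
    have a1 := h4 (k - 1); have a2 := h4 k; have a3 := h4 (j - 1); have a4 := h4 (k + 1)
    have b1 := h8' (k + 1); have b2 := h8' k; have b4 := h8' j
    have c1 := h9 (k + 1); have c2 := h9 k; have c3 := h9 j
    have d1 := h10 (k + 1); have d2 := h10 k; have d4 := h10 j
    have e1 := hinj' j
    simp only [Nat.add_sub_cancel] at b1
    clear h4 h8' h9 h10 hinj hinj'
    split_ifs
    all_goals grind
  · rintro ⟨j, k⟩ hkj
    simp only [coe_filter, mem_product, mem_Icc, Set.mem_ofPred_eq] at hkj ⊢
    have a1 := h4 (k + 1); have a2 := h4 k; have a3 := h4 j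
    have b1 := h8' (k + 1); have b2 := h8' k; have b3 := h8' (k + 1 + 1); have b4 := h8' (j + 1)
    have c1 := h9 (k + 1); have c2 := h9 k; have c3 := h9 j
    have d1 := h10 (k + 1); have d2 := h10 k; have d3 := h10 (k + 1 + 1); have d4 := h10 j
    have e1 := hinj j
    simp only [Nat.add_sub_cancel] at b1 b3 b4
    clear h4 h8' h9 h10 hinj hinj'
    split_ifs <;> try simp only [Nat.add_sub_cancel]
    all_goals grind
  · rintro ⟨j, k⟩ hkj
    simp only [coe_filter, mem_product, mem_Icc, Set.mem_ofPred_eq] at hkj ⊢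
    have a1 := h4 (k - 1); have a2 := h4 k; have a3 := h4 (j - 1); have a4 := h4 (k + 1)
    have b1 := h8' (k + 1); have b2 := h8' k; have b4 := h8' j
    have c1 := h9 (k + 1); have c2 := h9 k; have c3 := h9 j
    have d1 := h10 (k + 1); have d2 := h10 k; have d4 := h10 j
    have e1 := hinj' j
    simp only [Nat.add_sub_cancel] at b1
    clear h4 h8' h9 h10 hinj hinj'
    split_ifs
    all_goals grind

lemma prod_erase_eq {R : Type*} [CommMonoid R] (h : HopsTo f g x a i) (hin : i ≤ n)
    (F : ℕ → ℕ → ℕ → R)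
    (hF : ∀ y u u' v v', (y < u ↔ y < u') → (y < v ↔ y < v') → F y u v = F y u' v') :
    ∏ j ∈ (Icc 1 n).erase i, F (f j) (f (j - 1)) (f (j + 1)) =
    ∏ j ∈ (Icc 1 n).erase a, F (g j) (g (j - 1)) (g (j + 1)) := by
  have h8' : ∀ j, a < j → j ≤ i → g j = f (j - 1) := fun j => h.eq_pred
  obtain ⟨h1, h2, h3, h4, h5, h6, h7, -, h9, h10⟩ := h
  refine prod_nbij'
    (fun j => if a ≤ j ∧ j < i then j + 1 else j)
    (fun j => if a < j ∧ j ≤ i then j - 1 else j) ?_ ?_ ?_ ?_ ?_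
  · intro j hj
    simp only [mem_erase, mem_Icc] at hj ⊢
    grind
  · intro j hj
    simp only [mem_erase, mem_Icc] at hj ⊢
    grind
  · intro j hj
    simp only [mem_erase, mem_Icc] at hj ⊢
    grind
  · intro j hj
    simp only [mem_erase, mem_Icc] at hj ⊢
    grind
  · intro j hj
    simp only [mem_erase, mem_Icc] at hj ⊢
    have a1 := h4 j
    have b1 := h8' j; have b2 := h8' (j + 1); have b3 := h8' (j + 1 + 1)
    have c1 := h9 j; have c2 := h9 (j - 1); have c3 := h9 (j + 1)
    have d1 := h10 j; have d2 := h10 (j - 1); have d3 := h10 (j + 1); have d4 := h10 (j + 1 + 1)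
    have e1 := h4 (i - 1); have e2 := h4 a; have e3 := h8' i
    simp only [Nat.add_sub_cancel] at b2 b3
    clear h4 h8' h9 h10
    split_ifs with hc
    · simp only [Nat.add_sub_cancel]
      rw [b2 (by omega) (by omega)]
      apply hF <;> grind
    · have : g j = f j := by grind
      rw [this]
      apply hF <;> grind

lemma unique_right {g' : ℕ → ℕ} {a' i' : ℕ} (h : HopsTo f g x a i) (h' : HopsTo f g' x a' i')
    (hinj : ∀ j, f j = x → j = i) : g = g' := by
  obtain rfl := hinj _ h'.source
  have hle : a' = a := by
    have h1 := h.lt; have h2 := h'.lt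
    have h3 := h.left_lt; have h4 := h'.left_lt
    have h5 := h.large (a' - 1); have h6 := h'.large (a - 1)
    omega
  subst hle
  ext j
  rcases lt_or_ge j a' with hj | hj
  · rw [h.eq_left j hj, h'.eq_left j hj]
  rcases lt_or_ge i' j with hj' | hj'
  · rw [h.eq_right j hj', h'.eq_right j hj']
  rcases hj.eq_or_lt with rfl | hj
  · rw [h.target, h'.target]
  · rw [h.eq_pred hj hj', h'.eq_pred hj hj']

lemma unique_left {f' : ℕ → ℕ} {a' i' : ℕ} (h : HopsTo f g x a i) (h' : HopsTo f' g x a' i')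
    (hinj : ∀ j, f j = x → j = i) : f = f' := by
  obtain rfl := h.eq_of_target hinj h'.target
  have hle : i' = i := by
    have h1 := h.lt; have h2 := h'.lt
    have h3 := h.right_lt; have h4 := h'.right_lt
    have h5 := h.large i'; have h6 := h'.large i
    have h7 := h.shift i'; have h8 := h'.shift i
    have h9 := h.eq_right (i + 1); have h10 := h'.eq_right (i' + 1)
    omega
  subst hle
  ext j
  rcases lt_or_ge j a' with hj | hj
  · rw [← h.eq_left j hj, h'.eq_left j hj]
  rcases lt_or_ge i' j with hj' | hj'
  · rw [← h.eq_right j hj', h'.eq_right j hj']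
  rcases hj'.eq_or_lt with rfl | hj'
  · rw [h.source, h'.source]
  · rw [← h.shift j hj hj', h'.shift j hj hj']

lemma exists_right (hx : f i = x) (h0 : f 0 < x) (hl : x < f (i - 1)) (hr : f (i + 1) < x)
    (hinj : ∀ j, f j = x → j = i) : ∃ g a, HopsTo f g x a i := by
  have hi : i - 1 ≠ 0 := by rintro h; rw [h] at hl; omega
  obtain ⟨b, hbi, hb, hmax⟩ : ∃ b < i, f b < x ∧ ∀ j, b < j → j < i → x < f j := by
    refine ⟨Nat.findGreatest (fun j => f j < x) (i - 1), ?_, ?_, ?_⟩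
    · have := Nat.findGreatest_le (P := fun j => f j < x) (i - 1)
      omega
    · exact Nat.findGreatest_spec (P := fun j => f j < x) (Nat.zero_le (i - 1)) h0
    · intro j hj hji
      have h1 := Nat.findGreatest_is_greatest hj (by omega)
      have h2 := hinj j
      omega
  have hbi' : b ≠ i - 1 := by rintro rfl; omega
  refine ⟨fun j => if j = b + 1 then x else if b + 1 < j ∧ j ≤ i then f (j - 1) else f j, b + 1,
    by omega, by omega, hx, fun j hj hj' => hmax j (by omega) hj', by simpa using hb, hr,
    by simp, fun j hj hj' => ?_, fun j hj => ?_, fun j hj => ?_⟩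
  · rw [if_neg (by omega), if_pos (by omega), Nat.add_sub_cancel]
  · rw [if_neg (by omega), if_neg (by omega)]
  · rw [if_neg (by omega), if_neg (by omega)]

lemma exists_left (ha : 1 ≤ a) (hx : g a = x) (hl : g (a - 1) < x) (hr : x < g (a + 1))
    (hinj : ∀ j, g j = x → j = a) (hn : ∀ j, n < j → g j < x) : ∃ f i, HopsTo f g x a i := by
  have hex : ∃ b, a < b ∧ g b < x := ⟨a + n + 1, by omega, hn _ (by omega)⟩
  obtain ⟨hab, hb⟩ := Nat.find_spec hex
  have hmin : ∀ j, a < j → j < Nat.find hex → x < g j := fun j hj hj' => by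
    have h1 := Nat.find_min hex hj'
    have h2 := hinj j
    omega
  generalize Nat.find hex = b at hab hb hmin
  have hab' : b ≠ a + 1 := by rintro rfl; omega
  obtain ⟨i, rfl⟩ : ∃ i, b = i + 1 := ⟨b - 1, by omega⟩
  refine ⟨fun j => if j = i then x else if a ≤ j ∧ j < i then g (j + 1) else g j, i,
    ha, by omega, by simp, fun j hj hj' => ?_, ?_, ?_, hx, fun j hj hj' => ?_,
    fun j hj => ?_, fun j hj => ?_⟩
  · rw [if_neg (by omega), if_pos (by omega)]
    exact hmin _ (by omega) (by omega)
  · rwa [if_neg (by omega), if_neg (by omega)]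
  · rwa [if_neg (by omega), if_neg (by omega)]
  · rw [if_neg (by omega), if_pos (by omega)]
  · rw [if_neg (by omega), if_neg (by omega)]
  · rw [if_neg (by omega), if_neg (by omega)]

end HopsTo

/-- The words `f 1, …, f n` that are permutations of `1, …, n`, extended by zero. -/
structure IsPermWord (n : ℕ) (f : ℕ → ℕ) : Prop where
  mem : ∀ j, 1 ≤ j → j ≤ n → 1 ≤ f j ∧ f j ≤ n
  inj : ∀ j k, 1 ≤ f j → f j = f k → j = k
  zero : f 0 = 0
  eq_zero : ∀ j, n < j → f j = 0

lemma isPermWord_pval (n : ℕ) (σ : Equiv.Perm (Fin n)) : IsPermWord n (pval n σ) where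
  mem j h1 h2 := by
    have := (σ ⟨j - 1, by omega⟩).isLt
    rw [pval, dif_pos ⟨h1, h2⟩]
    omega
  inj j k h1 h := by
    unfold pval at h1 h
    split_ifs at h1 h with hj hk
    · have := σ.injective (Fin.ext (Nat.succ_injective h))
      simp only [Fin.mk.injEq] at this
      omega
    all_goals omega
  zero := by simp [pval]
  eq_zero j hj := dif_neg (by omega)

lemma pval_injective (n : ℕ) : Function.Injective (pval n) := by
  intro σ τ h
  ext k
  have := congrFun h (k + 1)
  have hk : 1 ≤ (k : ℕ) + 1 ∧ (k : ℕ) + 1 ≤ n := by omega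
  rw [pval, pval, dif_pos hk, dif_pos hk] at this
  simpa using this

lemma IsPermWord.exists_pval_eq {n : ℕ} {f : ℕ → ℕ} (h : IsPermWord n f) :
    ∃ σ, pval n σ = f := by
  have hlt : ∀ k : Fin n, f (k + 1) - 1 < n := fun k => by
    have := h.mem (k + 1) (by omega) (by omega)
    omega
  have hinj : Function.Injective (fun k : Fin n => (⟨f (k + 1) - 1, hlt k⟩ : Fin n)) := by
    intro k l hkl
    simp only [Fin.mk.injEq] at hkl
    have h1 := h.mem (k + 1) (by omega) (by omega)
    have h2 := h.mem (l + 1) (by omega) (by omega)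
    have h3 := h.inj (k + 1) (l + 1) h1.1 (by omega)
    exact Fin.ext (by omega)
  refine ⟨Equiv.ofBijective _ (Finite.injective_iff_bijective.mp hinj), ?_⟩
  ext j
  unfold pval
  split_ifs with hj
  · have := h.mem j hj.1 hj.2
    simp only [Equiv.ofBijective_apply, Nat.sub_add_cancel hj.1]
    omega
  · rcases Nat.eq_zero_or_pos j with rfl | hj'
    · exact h.zero.symm
    · exact (h.eq_zero j (by omega)).symm

namespace HopsTo

variable {f g : ℕ → ℕ} {x a i n : ℕ}

lemma isPermWord_right (h : HopsTo f g x a i) (hin : i ≤ n) (hf : IsPermWord n f) :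
    IsPermWord n g := by
  have h8' : ∀ j, a < j → j ≤ i → g j = f (j - 1) := fun j => h.eq_pred
  have key : ∀ j, g j = f (if j = a then i else if a < j ∧ j ≤ i then j - 1 else j) := by
    obtain ⟨h1, h2, h3, -, -, -, h7, -, h9, h10⟩ := h
    intro j
    have := h8' j; have := h9 j; have := h10 j
    split_ifs <;> grind
  have h1 := h.one_le
  have h2 := h.lt
  refine ⟨fun j hj hj' => ?_, fun j k hj hjk => ?_, ?_, fun j hj => ?_⟩
  · rw [key]
    apply hf.mem <;> split_ifs <;> omega
  · rw [key] at hj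
    rw [key, key] at hjk
    have := hf.inj _ _ hj hjk
    split_ifs at this <;> omega
  · rw [h.eq_left 0 (by omega), hf.zero]
  · rw [h.eq_right j (by omega), hf.eq_zero j hj]

lemma isPermWord_left (h : HopsTo f g x a i) (hin : i ≤ n) (hg : IsPermWord n g) :
    IsPermWord n f := by
  have key : ∀ j, f j = g (if j = i then a else if a ≤ j ∧ j < i then j + 1 else j) := by
    obtain ⟨h1, h2, h3, -, -, -, h7, h8, h9, h10⟩ := h
    intro j
    have := h8 j; have := h9 j; have := h10 j
    split_ifs <;> grind
  have h1 := h.one_le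
  have h2 := h.lt
  refine ⟨fun j hj hj' => ?_, fun j k hj hjk => ?_, ?_, fun j hj => ?_⟩
  · rw [key]
    apply hg.mem <;> split_ifs <;> omega
  · rw [key] at hj
    rw [key, key] at hjk
    have := hg.inj _ _ hj hjk
    split_ifs at this <;> omega
  · rw [← h.eq_left 0 (by omega), hg.zero]
  · rw [← h.eq_right j (by omega), hg.eq_zero j hj]

end HopsTo

lemma IsPermWord.mem_Icc_of_pos {n : ℕ} {f : ℕ → ℕ} (hf : IsPermWord n f) {j : ℕ}
    (hj : 0 < f j) : 1 ≤ j ∧ j ≤ n := by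
  constructor
  · by_contra h
    obtain rfl : j = 0 := by omega
    have := hf.zero
    omega
  · by_contra h
    have := hf.eq_zero j (by omega)
    omega

lemma IsPermWord.eq_of_eq {n : ℕ} {f : ℕ → ℕ} (hf : IsPermWord n f) {x i : ℕ} (hx : 0 < x)
    (hi : f i = x) (j : ℕ) (hj : f j = x) : j = i :=
  hf.inj j i (by omega) (by omega)

section Weight

variable {R : Type*} [CommRing R] (p q t : R)

/-- The weight of a letter `y` with left neighbour `u` and right neighbour `v`: a valley has
weight `t`, a double descent has weight `t` and a double ascent weight `1`, except that for
letters smaller than `m` these last two weights are `0` and `1 + t`. -/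
def hopWeight (m y u v : ℕ) : R :=
  if y < u then if y < v then t else if y < m then 0 else t
  else if y < v then if y < m then 1 + t else 1 else 1

/-- The product of the weights `hopWeight` of all letters of a word. -/
def hopProd (m n : ℕ) (f : ℕ → ℕ) : R :=
  ∏ j ∈ Icc 1 n, hopWeight t m (f j) (f (j - 1)) (f (j + 1))

lemma hopWeight_succ {m y : ℕ} (u v : ℕ) (h : y ≠ m) :
    hopWeight t (m + 1) y u v = hopWeight t m y u v := by
  have : y < m + 1 ↔ y < m := by omega
  simp only [hopWeight, this]

lemma HopsTo.hopProd_add {f g : ℕ → ℕ} {m a i n : ℕ} (h : HopsTo f g m a i) (hin : i ≤ n)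
    (hinj : ∀ j, f j = m → j = i) :
    hopProd t m n f + hopProd t m n g = hopProd t (m + 1) n f + hopProd t (m + 1) n g := by
  have h1 := h.one_le
  have h2 := h.lt
  have hi : i ∈ Icc 1 n := mem_Icc.mpr ⟨by omega, hin⟩
  have ha : a ∈ Icc 1 n := mem_Icc.mpr ⟨h1, by omega⟩
  have hcongr : ∀ m, ∀ y u u' v v' : ℕ, (y < u ↔ y < u') → (y < v ↔ y < v') →
      hopWeight t m y u v = hopWeight t m y u' v' := fun m y u u' v v' hu hv => by
    simp only [hopWeight, hu, hv]
  have hsucc : ∏ j ∈ (Icc 1 n).erase i, hopWeight t (m + 1) (f j) (f (j - 1)) (f (j + 1)) =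
      ∏ j ∈ (Icc 1 n).erase i, hopWeight t m (f j) (f (j - 1)) (f (j + 1)) :=
    prod_congr rfl fun j hj => hopWeight_succ t _ _ fun hfj => (mem_erase.mp hj).1 (hinj j hfj)
  unfold hopProd
  have hsplit : ∀ (w : ℕ → ℕ) (k b : ℕ), b ∈ Icc 1 n →
      ∏ j ∈ Icc 1 n, hopWeight t k (w j) (w (j - 1)) (w (j + 1)) =
        hopWeight t k (w b) (w (b - 1)) (w (b + 1)) *
          ∏ j ∈ (Icc 1 n).erase b, hopWeight t k (w j) (w (j - 1)) (w (j + 1)) :=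
    fun w k b hb => (mul_prod_erase (Icc 1 n)
      (fun j => hopWeight t k (w j) (w (j - 1)) (w (j + 1))) hb).symm
  rw [hsplit f m i hi, hsplit g m a ha, hsplit f (m + 1) i hi, hsplit g (m + 1) a ha,
    ← h.prod_erase_eq hin _ (hcongr m),
    ← h.prod_erase_eq hin _ (hcongr (m + 1)), hsucc]
  have hfl := h.large (i - 1) (by omega) (by omega)
  have hgr := h.shift a le_rfl h2
  have hgr' := h.large a le_rfl h2
  have hgl := h.eq_left (a - 1) (by omega)
  have hfr := h.right_lt
  have hgl' := h.left_lt
  have e1 : ∀ k, hopWeight t k (f i) (f (i - 1)) (f (i + 1)) = if m < k then 0 else t :=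
    fun k => by
      rw [h.source, hopWeight, if_pos hfl, if_neg (by omega)]
  have e2 : ∀ k, hopWeight t k (g a) (g (a - 1)) (g (a + 1)) = if m < k then 1 + t else 1 :=
    fun k => by
      rw [h.target, hopWeight, if_neg (by omega), if_pos (by omega)]
  rw [e1, e1, e2, e2]
  simp only [lt_irrefl, Nat.lt_succ_self, if_true, if_false]
  ring

lemma hopProd_succ {m n : ℕ} {f : ℕ → ℕ} (hf : IsPermWord n f)
    (hd : ¬∃ i, f i = m ∧ f i < f (i - 1) ∧ f (i + 1) < f i)
    (hu : ¬∃ i, f i = m ∧ f (i - 1) < f i ∧ f i < f (i + 1)) :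
    hopProd t (m + 1) n f = hopProd t m n f := by
  refine prod_congr rfl fun j hj => ?_
  rw [mem_Icc] at hj
  by_cases hfj : f j = m
  · have hpos := (hf.mem j hj.1 hj.2).1
    have h1 : f j ≠ f (j - 1) := fun h => by
      have := hf.inj _ _ hpos h
      omega
    have h2 : f j ≠ f (j + 1) := fun h => by
      have := hf.inj _ _ hpos h
      omega
    push Not at hd hu
    have hd' := hd j hfj
    have hu' := hu j hfj
    unfold hopWeight
    split_ifs <;> first | rfl | omega
  · exact hopWeight_succ t _ _ hfj

lemma sum_hopProd_succ (m n : ℕ) :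
    ∑ σ : Equiv.Perm (Fin n), p ^ res n σ * q ^ les n σ * hopProd t m n (pval n σ) =
    ∑ σ : Equiv.Perm (Fin n), p ^ res n σ * q ^ les n σ * hopProd t (m + 1) n (pval n σ) := by
  classical
  let D : Finset (Equiv.Perm (Fin n)) := univ.filter fun σ =>
    ∃ i, pval n σ i = m ∧ pval n σ i < pval n σ (i - 1) ∧ pval n σ (i + 1) < pval n σ i
  let U : Finset (Equiv.Perm (Fin n)) := univ.filter fun σ =>
    ∃ i, pval n σ i = m ∧ pval n σ (i - 1) < pval n σ i ∧ pval n σ i < pval n σ (i + 1)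
  let Δ : Equiv.Perm (Fin n) → R := fun σ =>
    p ^ res n σ * q ^ les n σ * (hopProd t m n (pval n σ) - hopProd t (m + 1) n (pval n σ))
  have hpos : ∀ σ i, pval n σ i = m → 0 < pval n σ i → ∀ j, pval n σ j = m → j = i :=
    fun σ i hi hpos => (isPermWord_pval n σ).eq_of_eq (by omega) hi
  have hexD : ∀ σ ∈ D, ∃ τ ∈ U, ∃ a i, HopsTo (pval n σ) (pval n τ) m a i := by
    intro σ hσ
    obtain ⟨i, hi, hl, hr⟩ := (mem_filter.mp hσ).2
    have hw := isPermWord_pval n σ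
    have hin := (hw.mem_Icc_of_pos (j := i) (by omega)).2
    obtain ⟨g, a, h⟩ := HopsTo.exists_right hi (by rw [hw.zero]; omega) (by omega) (by omega)
      (hpos σ i hi (by omega))
    obtain ⟨τ, rfl⟩ := (h.isPermWord_right hin hw).exists_pval_eq
    refine ⟨τ, mem_filter.mpr ⟨mem_univ _, a, h.target, ?_, ?_⟩, a, i, h⟩
    · rw [h.target, h.eq_left _ (by have := h.one_le; omega)]
      exact h.left_lt
    · rw [h.target, h.shift a le_rfl h.lt]
      exact h.large a le_rfl h.lt
  have hexU : ∀ τ ∈ U, ∃ σ ∈ D, ∃ a i, HopsTo (pval n σ) (pval n τ) m a i := by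
    intro τ hτ
    obtain ⟨a, ha, hl, hr⟩ := (mem_filter.mp hτ).2
    have hw := isPermWord_pval n τ
    have han := hw.mem_Icc_of_pos (j := a) (by omega)
    obtain ⟨f, i, h⟩ := HopsTo.exists_left (n := n) han.1 ha (by omega) (by omega)
      (hpos τ a ha (by omega)) (fun j hj => by rw [hw.eq_zero j hj]; omega)
    have hai := h.lt
    have hin : i ≤ n := by
      have h1 := h.large (i - 1) (by omega) (by omega)
      have h2 := h.shift (i - 1) (by omega) (by omega)
      rw [Nat.sub_add_cancel (by omega)] at h2
      exact (hw.mem_Icc_of_pos (j := i) (by omega)).2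
    obtain ⟨σ, rfl⟩ := (h.isPermWord_left hin hw).exists_pval_eq
    refine ⟨σ, mem_filter.mpr ⟨mem_univ _, i, h.source, ?_, ?_⟩, a, i, h⟩
    · rw [h.source]
      exact h.large (i - 1) (by omega) (by omega)
    · rw [h.source]
      exact h.right_lt
  have hinj : ∀ σ ∈ D, ∀ τ a i, HopsTo (pval n σ) (pval n τ) m a i →
      ∀ j, pval n σ j = m → j = i := by
    intro σ _ τ a i h
    have h1 := h.left_lt
    have h2 := h.source
    exact hpos σ i h.source (by omega)
  have hdisj : Disjoint D U := by
    rw [disjoint_left]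
    intro σ hD hU
    obtain ⟨i, hi, hl, hr⟩ := (mem_filter.mp hD).2
    obtain ⟨j, hj, hl', hr'⟩ := (mem_filter.mp hU).2
    obtain rfl := hpos σ i hi (by omega) j hj
    omega
  have hzero : ∑ σ, Δ σ = 0 := by
    rw [← sum_subset (subset_univ (D ∪ U)), sum_union hdisj, add_eq_zero_iff_eq_neg,
      ← sum_neg_distrib]
    · choose! φ hφU hφ using hexD
      refine sum_bij (fun σ _ => φ σ) hφU ?_ ?_ ?_
      · intro σ hσ σ' hσ' heq
        obtain ⟨a, i, h⟩ := hφ σ hσ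
        obtain ⟨a', i', h'⟩ := hφ σ' hσ'
        have heq : φ σ = φ σ' := heq
        rw [← heq] at h'
        exact pval_injective n (h.unique_left h' (hinj σ hσ _ a i h))
      · intro τ hτ
        obtain ⟨σ, hσ, a, i, h⟩ := hexU τ hτ
        obtain ⟨a', i', h'⟩ := hφ σ hσ
        exact ⟨σ, hσ, (pval_injective n (h.unique_right h' (hinj σ hσ _ a i h))).symm⟩
      · intro σ hσ
        obtain ⟨a, i, h⟩ := hφ σ hσ
        have hσi := hinj σ hσ _ a i h
        have hin : i ≤ n := by
          have h1 := h.left_lt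
          have h2 := h.source
          exact ((isPermWord_pval n σ).mem_Icc_of_pos (j := i) (by omega)).2
        have hres : res n σ = res n (φ σ) := h.card_res hin hσi
        have hles : les n σ = les n (φ σ) := h.card_les hin hσi
        have hadd := h.hopProd_add t hin hσi
        simp only [Δ]
        rw [hres, hles]
        linear_combination p ^ res n (φ σ) * q ^ les n (φ σ) * hadd
    · intro σ _ hσ
      simp only [D, U, mem_union, mem_filter, mem_univ, true_and, not_or] at hσ
      simp only [Δ]
      rw [hopProd_succ t (isPermWord_pval n σ) hσ.1 hσ.2, sub_self, mul_zero]
  rw [← sub_eq_zero, ← sum_sub_distrib, ← hzero]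
  exact sum_congr rfl fun σ _ => by simp only [Δ]; ring

lemma card_filter_lt_pred (n : ℕ) (σ : Equiv.Perm (Fin n)) :
    ((Icc 1 n).filter fun j => pval n σ j < pval n σ (j - 1)).card = des n σ := by
  rw [des]
  refine (card_nbij' (· + 1) (· - 1) ?_ ?_ ?_ ?_).symm
  · intro j hj
    simp only [coe_filter, mem_Icc, Set.mem_ofPred_eq, Nat.add_sub_cancel] at hj ⊢
    exact ⟨by omega, hj.2⟩
  · intro j hj
    simp only [coe_filter, mem_Icc, Set.mem_ofPred_eq] at hj ⊢
    have hj1 : j ≠ 1 := by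
      rintro rfl
      have := hj.2
      simp [pval] at this
    rw [Nat.sub_add_cancel hj.1.1]
    exact ⟨by omega, hj.2⟩
  · intro j _
    simp
  · intro j hj
    simp only [coe_filter, mem_Icc, Set.mem_ofPred_eq] at hj
    exact Nat.sub_add_cancel hj.1.1

lemma pval_ne_pval {n j k : ℕ} (σ : Equiv.Perm (Fin n)) (hj : j ∈ Icc 1 n) (hjk : j ≠ k) :
    pval n σ j ≠ pval n σ k := fun h => by
  have hw := isPermWord_pval n σ
  rw [mem_Icc] at hj
  exact hjk (hw.inj j k (hw.mem j hj.1 hj.2).1 h)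

lemma card_filter_lt_succ_add_des (n : ℕ) (σ : Equiv.Perm (Fin n)) :
    ((Icc 1 n).filter fun j => pval n σ j < pval n σ (j + 1)).card + des n σ = n - 1 := by
  have h : ((Icc 1 n).filter fun j => pval n σ j < pval n σ (j + 1)) =
      (Icc 1 (n - 1)).filter fun j => ¬pval n σ (j + 1) < pval n σ j := by
    ext j
    simp only [mem_filter, mem_Icc]
    constructor
    · rintro ⟨hj, hlt⟩
      have := ((isPermWord_pval n σ).mem_Icc_of_pos (j := j + 1) (by omega)).2
      omega
    · rintro ⟨hj, hlt⟩
      have := pval_ne_pval σ (k := j + 1) (mem_Icc.mpr ⟨hj.1, by omega⟩) (by omega)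
      omega
  rw [h, des, add_comm, card_filter_add_card_filter_not, Nat.card_Icc]
  omega

lemma valleys_add_ddes (n : ℕ) (σ : Equiv.Perm (Fin n)) :
    valleys n σ + ddes n σ = des n σ := by
  have h := card_filter_add_card_filter_not
    (s := (Icc 1 n).filter fun j => pval n σ j < pval n σ (j - 1))
    (fun j => pval n σ j < pval n σ (j + 1))
  rw [filter_filter, filter_filter, card_filter_lt_pred] at h
  rw [← h, valleys, ddes]
  congr 2
  refine filter_congr fun j hj => ?_
  have := pval_ne_pval σ (k := j + 1) hj (by omega)
  omega

lemma valleys_add_card_double_ascents (n : ℕ) (σ : Equiv.Perm (Fin n)) :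
    valleys n σ + ((Icc 1 n).filter fun j =>
      ¬pval n σ j < pval n σ (j - 1) ∧ pval n σ j < pval n σ (j + 1)).card + des n σ = n - 1 := by
  have h := card_filter_add_card_filter_not
    (s := (Icc 1 n).filter fun j => pval n σ j < pval n σ (j + 1))
    (fun j => pval n σ j < pval n σ (j - 1))
  rw [filter_filter, filter_filter] at h
  rw [← card_filter_lt_succ_add_des n σ, ← h, valleys]
  simp only [and_comm]

lemma hopProd_zero (n : ℕ) (σ : Equiv.Perm (Fin n)) :
    hopProd t 0 n (pval n σ) = t ^ des n σ := by
  have h1 : hopProd t 0 n (pval n σ) =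
      ∏ j ∈ Icc 1 n, if pval n σ j < pval n σ (j - 1) then t else 1 :=
    prod_congr rfl fun j _ => by simp [hopWeight]
  rw [h1, prod_ite, prod_const, prod_const_one, mul_one, card_filter_lt_pred]

lemma hopProd_add_one (n : ℕ) (σ : Equiv.Perm (Fin n)) :
    hopProd t (n + 1) n (pval n σ) =
      if ddes n σ = 0 then t ^ valleys n σ * (1 + t) ^ (n - 1 - 2 * valleys n σ) else 0 := by
  have h1 : hopProd t (n + 1) n (pval n σ) =
      ∏ j ∈ Icc 1 n,
        (if pval n σ j < pval n σ (j - 1) ∧ pval n σ j < pval n σ (j + 1) then t else 1) *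
        (if pval n σ j < pval n σ (j - 1) ∧ pval n σ (j + 1) < pval n σ j then 0 else 1) *
        (if ¬pval n σ j < pval n σ (j - 1) ∧ pval n σ j < pval n σ (j + 1)
          then 1 + t else 1) := by
    refine prod_congr rfl fun j hj => ?_
    have hne := pval_ne_pval σ (k := j + 1) hj (by omega)
    rw [mem_Icc] at hj
    have hle : pval n σ j < n + 1 :=
      Nat.lt_succ_of_le ((isPermWord_pval n σ).mem j hj.1 hj.2).2
    rw [hopWeight, if_pos hle, if_pos hle]
    rcases lt_or_ge (pval n σ j) (pval n σ (j - 1)) with h | h <;>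
      rcases lt_or_gt_of_ne hne with h' | h' <;>
      simp [h, h', h.not_gt, h'.not_gt]
  have h2 := valleys_add_ddes n σ
  have h3 := valleys_add_card_double_ascents n σ
  rw [h1, prod_mul_distrib, prod_mul_distrib, prod_ite, prod_ite, prod_ite]
  simp only [prod_const, one_pow, mul_one]
  change t ^ valleys n σ * 0 ^ ddes n σ * _ = _
  split_ifs with hd
  · rw [hd, pow_zero, mul_one]
    congr 2
    omega
  · rw [zero_pow hd, mul_zero, zero_mul]

end Weight

/-- The generalized Eulerian polynomial
`A_n(p,q,t) = Σ_σ p^(res σ) q^(les σ) t^(des σ)` satisfies the γ-expansion with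
`a_{n,k}(p,q) = Σ_{σ ∈ S_{n,k}} p^(res σ) q^(les σ)`. -/
theorem statement3 (n : ℕ) (hn : 0 < n) :
    (∑ σ : Equiv.Perm (Fin n),
      (X 0 : MvPolynomial (Fin 3) ℤ) ^ (res n σ) * (X 1) ^ (les n σ) * (X 2) ^ (des n σ)) =
    ∑ k ∈ Finset.range ((n - 1) / 2 + 1),
      (∑ σ ∈ Snk n k, (X 0 : MvPolynomial (Fin 3) ℤ) ^ (res n σ) * (X 1) ^ (les n σ)) *
        (X 2) ^ k * (1 + X 2) ^ (n - 1 - 2 * k) := by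
  have hiter : ∀ m, ∑ σ : Equiv.Perm (Fin n), (X 0 : MvPolynomial (Fin 3) ℤ) ^ res n σ *
      X 1 ^ les n σ * hopProd (X 2) 0 n (pval n σ) =
      ∑ σ : Equiv.Perm (Fin n), (X 0 : MvPolynomial (Fin 3) ℤ) ^ res n σ *
      X 1 ^ les n σ * hopProd (X 2) m n (pval n σ) := fun m => by
    induction m with
    | zero => rfl
    | succ m ih => rw [ih, sum_hopProd_succ]
  have h := hiter (n + 1)
  simp only [hopProd_zero, hopProd_add_one, mul_ite, mul_zero] at h
  rw [h, ← sum_filter]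
  have hmaps : ∀ σ ∈ univ.filter (fun σ : Equiv.Perm (Fin n) => ddes n σ = 0),
      valleys n σ ∈ range ((n - 1) / 2 + 1) := fun σ hσ => by
    have h1 := (mem_filter.mp hσ).2
    have h2 := valleys_add_ddes n σ
    have h3 := valleys_add_card_double_ascents n σ
    rw [mem_range]
    omega
  rw [← sum_fiberwise_of_maps_to hmaps]
  refine sum_congr rfl fun k _ => ?_
  have hS : Snk n k = (univ.filter fun σ : Equiv.Perm (Fin n) => ddes n σ = 0).filter
      fun σ => valleys n σ = k := by
    rw [Snk, filter_filter]
    simp only [and_comm]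
  rw [sum_mul, sum_mul, hS]
  refine sum_congr rfl fun σ hσ => ?_
  rw [(mem_filter.mp hσ).2]
  ring
end
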